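/- Given M > 0, the following holds provided α > 0 is small enough. Let X : [0,1) → B_α be an admissible curve with return times n_k. For each k = 1,2,…, the set ℬ_k(M) = {θ ∈ [0,1) : n_k(θ) is defined and n_k(θ) ≤ (N(α)+M)·k} has Lebesgue measure at most 0.8^k. In particular, for Lebesgue-a.e. θ ∈ [0,1) for which all n_k(θ) are defined, n_k(θ) > (N(α)+M)·k for all sufficiently large k. -/

import Mathlib

open Set MeasureTheory Filter
open scoped ENNReal

noncomputable section

/-- The quadratic map `f(x) = a - x²`. -/
def qm (a : ℝ) : ℝ → ℝ := fun x => a - x ^ 2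

/-- The critical point `0` of `qm a` is strictly pre-periodic: its forward orbit never
returns to `0` and is eventually periodic. -/
def StrictlyPreperiodic (a : ℝ) : Prop :=
  (∀ i : ℕ, 1 ≤ i → (qm a)^[i] 0 ≠ 0) ∧
    ∃ m p : ℕ, 1 ≤ m ∧ 1 ≤ p ∧ (qm a)^[m + p] 0 = (qm a)^[m] 0

/-- A lift of the Viana skew product `F(θ, x) = (dθ, f(x) + αφ(θ))` to `ℝ × ℝ`;
for `φ` of period `1` this is a lift of the corresponding map of `(ℝ/ℤ) × ℝ`. -/
def Viana (a : ℝ) (d : ℕ) (φ : ℝ → ℝ) (α : ℝ) : ℝ × ℝ → ℝ × ℝ :=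
  fun p => ((d : ℝ) * p.1, qm a p.2 + α * φ p.1)

/-- The fibre maps `f_n`, defined by `F^n(θ, x) = (d^n θ, f_n(θ, x))`. -/
def fn (a : ℝ) (d : ℕ) (φ : ℝ → ℝ) (α : ℝ) (n : ℕ) (θ x : ℝ) : ℝ :=
  ((Viana a d φ α)^[n] (θ, x)).2

/-- Endpoints of the shadowing intervals: `IEnd a α n` gives the endpoints of `I_{n+1}`, where
`I₁ = [c₁ - 2α, c₁ + 2α]` and `I_{n+1}` is the closed interval containing `f(I_n)` both of whose
complementary components in `I_{n+1}` have length `α`. -/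
def IEnd (a α : ℝ) : ℕ → ℝ × ℝ
  | 0 => (qm a 0 - 2 * α, qm a 0 + 2 * α)
  | n + 1 =>
      (sInf (qm a '' Set.Icc (IEnd a α n).1 (IEnd a α n).2) - α,
        sSup (qm a '' Set.Icc (IEnd a α n).1 (IEnd a α n).2) + α)

/-- The shadowing interval `I_n`, for `n ≥ 1`. -/
def Iseq (a α : ℝ) (n : ℕ) : Set ℝ := Set.Icc (IEnd a α (n - 1)).1 (IEnd a α (n - 1)).2

/-- The length `|I_{n+1}|` of the shadowing interval `I_{n+1}`. -/
def len (a α : ℝ) (n : ℕ) : ℝ := (IEnd a α n).2 - (IEnd a α n).1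

/-- `N(α)`: the maximal integer `N` such that `|I_n| < ξ₀` for all `1 ≤ n ≤ N` and
`∑_{n=1}^{N} |I_n| ≤ ξ₀`. -/
def Nal (a ξ₀ α : ℝ) : ℕ :=
  sSup {N : ℕ | (∀ n : ℕ, 1 ≤ n → n ≤ N → len a α (n - 1) < ξ₀) ∧
    ∑ n ∈ Finset.range N, len a α n ≤ ξ₀}

/-- A curve `X : [0,1) → B = [-β, β]` is admissible if it is the image of a horizontal curve
under `F^n` for some `n ≥ n₀ + 1`: there are `ω = [j/dⁿ, (j+1)/dⁿ) ∈ 𝒫_n` and `x₀ ∈ B` with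
`X(dⁿθ mod 1) = f_n(θ, x₀)` for all `θ ∈ ω`; equivalently `X(t) = f_n((t+j)/dⁿ, x₀)` on `[0,1)`. -/
def Admissible (a : ℝ) (d : ℕ) (φ : ℝ → ℝ) (α β : ℝ) (n₀ : ℕ) (X : ℝ → ℝ) : Prop :=
  ∃ n : ℕ, n₀ + 1 ≤ n ∧ ∃ j : ℕ, j < d ^ n ∧ ∃ x₀ ∈ Set.Icc (-β) β,
    ∀ θ ∈ Set.Ico (0 : ℝ) 1, X θ = fn a d φ α n ((θ + j) / (d : ℝ) ^ n) x₀

/-- `IsRet … X θ n` holds iff `n = 0` or `n` is a return time of `θ` for the curve `X`: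
there is `θ'` in the same element of the partition `𝒫_n` of `[0,1)` as `θ` with
`|f_n(θ', X(θ'))| ≤ α^{0.6}`. -/
def IsRet (a : ℝ) (d : ℕ) (φ : ℝ → ℝ) (α : ℝ) (X : ℝ → ℝ) (θ : ℝ) (n : ℕ) : Prop :=
  n = 0 ∨ 1 ≤ n ∧ ∃ θ' ∈ Set.Ico (0 : ℝ) 1,
    ⌊θ' * (d : ℝ) ^ n⌋ = ⌊θ * (d : ℝ) ^ n⌋ ∧ |fn a d φ α n θ' (X θ')| ≤ α ^ (0.6 : ℝ)

/-- `n_k(θ)` is defined, i.e. `{0} ∪ {return times of θ}` has more than `k` elements. -/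
def NkDef (a : ℝ) (d : ℕ) (φ : ℝ → ℝ) (α : ℝ) (X : ℝ → ℝ) (θ : ℝ) (k : ℕ) : Prop :=
  {n : ℕ | IsRet a d φ α X θ n}.Infinite ∨ k < {n : ℕ | IsRet a d φ α X θ n}.ncard

/-- `n_k(θ)`: the `k`-th smallest element of `{0} ∪ {return times of θ}` (so `n₀(θ) = 0`). -/
def nk (a : ℝ) (d : ℕ) (φ : ℝ → ℝ) (α : ℝ) (X : ℝ → ℝ) (θ : ℝ) (k : ℕ) : ℕ :=
  Nat.nth (IsRet a d φ α X θ) k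

/-! ### Expansion along the critical cycle -/

lemma prod_range_add_of_periodic (g : ℕ → ℝ) (p : ℕ) (hg : ∀ i, g (i + p) = g i) (n : ℕ) :
    ∏ i ∈ Finset.range p, g (n + i) = ∏ i ∈ Finset.range p, g i := by
  induction n with
  | zero => simp
  | succ n ih =>
    rw [← ih]
    by_cases h : ∃ i, g i = 0
    · rcases Nat.eq_zero_or_pos p with rfl | hp
      · simp
      obtain ⟨i, hi⟩ := h
      have key : ∀ n, ∏ j ∈ Finset.range p, g (n + j) = 0 := by
        intro n
        have hmod : ∀ j k, g (j + k * p) = g j := by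
          intro j k
          induction k with
          | zero => simp
          | succ k ih => rw [Nat.succ_mul, ← add_assoc, hg, ih]
        have hz : g (i + n * p) = 0 := by rw [hmod, hi]
        refine Finset.prod_eq_zero (i := (i + n * p - n) % p) (Finset.mem_range.2 (Nat.mod_lt _ hp)) ?_
        have hle : n ≤ i + n * p := le_add_left (Nat.le_mul_of_pos_right n hp)
        have h2 := hmod (n + (i + n * p - n) % p) ((i + n * p - n) / p)
        rw [← h2, add_assoc, Nat.mod_add_div', Nat.add_sub_cancel' hle, hz]
      rw [key, key]
    · push Not at h
      have h1 := Finset.prod_range_succ (fun i => g (n + i)) p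
      have h2 := Finset.prod_range_succ' (fun i => g (n + i)) p
      rw [h1] at h2
      simp only [hg, add_zero] at h2
      have h3 := mul_right_cancel₀ (h n) h2
      rw [h3]
      exact Finset.prod_congr rfl fun i _ => by congr 1; ring

lemma pullback_step_pos {a x z y w : ℝ} (ha : a ≤ 2) (hw : 0 < w) (hz : a - w ^ 2 = z)
    (hxy : (x - z) * (y - z) < 0) (hxa : x < a) (hya : y < a) (hx2 : |x| ≤ 2) (hy2 : |y| ≤ 2) :
    ∃ x' y' : ℝ, 0 < x' ∧ 0 < y' ∧ a - x' ^ 2 = x ∧ a - y' ^ 2 = y ∧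
      (x' - w) * (y' - w) < 0 ∧ |x'| ≤ 2 ∧ |y'| ≤ 2 ∧
      (1 / |x' - w| + 1 / |y' - w|) * (1 + |x' - w| * |y' - w| / 16) ≤
        2 * |w| * (1 / |x - z| + 1 / |y - z|) := by
  have main : ∀ x y : ℝ, x < z → z < y → x < a → y < a → |x| ≤ 2 → |y| ≤ 2 →
      ∃ x' y' : ℝ, 0 < x' ∧ 0 < y' ∧ a - x' ^ 2 = x ∧ a - y' ^ 2 = y ∧
      (x' - w) * (y' - w) < 0 ∧ |x'| ≤ 2 ∧ |y'| ≤ 2 ∧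
      (1 / |x' - w| + 1 / |y' - w|) * (1 + |x' - w| * |y' - w| / 16) ≤
        2 * |w| * (1 / |x - z| + 1 / |y - z|) := by
    intro x y hxz hzy hxa hya hx2 hy2
    have hx' : 0 < √(a - x) := Real.sqrt_pos.2 (by linarith)
    have hy' : 0 < √(a - y) := Real.sqrt_pos.2 (by linarith)
    have hxs : √(a - x) ^ 2 = a - x := Real.sq_sqrt (by linarith)
    have hys : √(a - y) ^ 2 = a - y := Real.sq_sqrt (by linarith)
    set X := √(a - x)
    set Y := √(a - y)
    obtain ⟨hx3, hx4⟩ := abs_le.1 hx2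
    obtain ⟨hy3, hy4⟩ := abs_le.1 hy2
    have hX : w < X := by nlinarith
    have hY : Y < w := by nlinarith
    have hX2 : X ≤ 2 := by nlinarith
    have hY2 : Y ≤ 2 := by linarith
    refine ⟨X, Y, hx', hy', by linarith, by linarith, by nlinarith, by rwa [abs_of_pos hx'],
      by rwa [abs_of_pos hy'], ?_⟩
    have e1 : |x - z| = (X - w) * (X + w) := by
      rw [abs_of_neg (by linarith)]; linear_combination -hxs - hz
    have e2 : |y - z| = (w - Y) * (Y + w) := by
      rw [abs_of_pos (by linarith)]; linear_combination hz + hys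
    rw [e1, e2, abs_of_pos hw, abs_of_pos (by linarith : 0 < X - w),
      abs_of_neg (by linarith : Y - w < 0)]
    obtain ⟨P, hP⟩ : ∃ P, P = X - w := ⟨_, rfl⟩
    obtain ⟨Q, hQ⟩ : ∃ Q, Q = w - Y := ⟨_, rfl⟩
    have hP0 : 0 < P := by linarith
    have hQ0 : 0 < Q := by linarith
    have hA : 0 < X + w := by linarith
    have hB : 0 < Y + w := by linarith
    have hAB : (X + w) * (Y + w) ≤ 16 := by nlinarith
    rw [neg_sub, ← hP, ← hQ]
    have l : (1 / P + 1 / Q) * (1 + P * Q / 16)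
        = (P + Q) * (1 + P * Q / 16) * ((X + w) * (Y + w)) / (P * Q * ((X + w) * (Y + w))) := by
      field_simp
      ring
    have r : 2 * w * (1 / (P * (X + w)) + 1 / (Q * (Y + w)))
        = 2 * w * (Q * (Y + w) + P * (X + w)) / (P * Q * ((X + w) * (Y + w))) := by
      field_simp
    rw [l, r]
    refine div_le_div_of_nonneg_right ?_ (by positivity)
    have hX' : X = w + P := by linarith
    have hY' : Y = w - Q := by linarith
    have e : 2 * w * (Q * (Y + w) + P * (X + w)) =
        (P + Q) * ((X + w) * (Y + w)) + (P + Q) * (P * Q) := by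
      rw [hX', hY']; ring
    rw [e]
    have : (P + Q) * (P * Q) * ((X + w) * (Y + w)) ≤ (P + Q) * (P * Q) * 16 := by gcongr
    have e' : (P + Q) * (1 + P * Q / 16) * ((X + w) * (Y + w)) =
        (P + Q) * ((X + w) * (Y + w)) + (P + Q) * (P * Q) * ((X + w) * (Y + w)) / 16 := by ring
    linarith
  rcases mul_neg_iff.1 hxy with ⟨h1, h2⟩ | ⟨h1, h2⟩
  · obtain ⟨y', x', h⟩ := main y x (by linarith) (by linarith) hya hxa hy2 hx2
    refine ⟨x', y', h.2.1, h.1, h.2.2.2.1, h.2.2.1, ?_, h.2.2.2.2.2.2.1, h.2.2.2.2.2.1, ?_⟩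
    · rw [mul_comm]; exact h.2.2.2.2.1
    · rw [add_comm (1 / |x' - w|), add_comm (1 / |x - z|), mul_comm |x' - w|]
      exact h.2.2.2.2.2.2.2
  · exact main x y (by linarith) (by linarith) hxa hya hx2 hy2

lemma pullback_step {a x z y w : ℝ} (ha : a ≤ 2) (hw : w ≠ 0) (hz : a - w ^ 2 = z)
    (hxy : (x - z) * (y - z) < 0) (hxa : x < a) (hya : y < a) (hx2 : |x| ≤ 2) (hy2 : |y| ≤ 2) :
    ∃ x' y' : ℝ, 0 < x' * y' ∧ a - x' ^ 2 = x ∧ a - y' ^ 2 = y ∧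
      (x' - w) * (y' - w) < 0 ∧ |x'| ≤ 2 ∧ |y'| ≤ 2 ∧
      (1 / |x' - w| + 1 / |y' - w|) * (1 + |x' - w| * |y' - w| / 16) ≤
        2 * |w| * (1 / |x - z| + 1 / |y - z|) := by
  rcases lt_or_gt_of_ne hw with h | h
  · obtain ⟨x', y', h1, h2, h3, h4, h5, h6, h7, h8⟩ :=
      pullback_step_pos (w := -w) ha (by linarith) (by simpa using hz) hxy hxa hya hx2 hy2
    refine ⟨-x', -y', by simpa using mul_pos h1 h2, by simpa using h3, by simpa using h4,
      by linarith, by simpa using h6, by simpa using h7, ?_⟩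
    have e1 : |-x' - w| = |x' - -w| := by rw [← abs_neg]; congr 1; ring
    have e2 : |-y' - w| = |y' - -w| := by rw [← abs_neg]; congr 1; ring
    rw [e1, e2]
    simpa using h8
  · obtain ⟨x', y', h1, h2, h3⟩ := pullback_step_pos ha h hz hxy hxa hya hx2 hy2
    exact ⟨x', y', mul_pos h1 h2, h3⟩

lemma qm_injOn_mapsTo_uIcc (a : ℝ) {x y : ℝ} (h : 0 < x * y) :
    InjOn (qm a) (uIcc x y) ∧ MapsTo (qm a) (uIcc x y) (uIcc (qm a x) (qm a y)) := by
  have hs : ∀ u ∈ uIcc x y, 0 < u * x ∧ 0 < u * y := by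
    intro u hu
    rcases mem_uIcc.1 hu with ⟨h1, h2⟩ | ⟨h1, h2⟩ <;>
    rcases mul_pos_iff.1 h with ⟨h3, h4⟩ | ⟨h3, h4⟩ <;> constructor <;> nlinarith
  constructor
  · intro u hu v hv huv
    simp only [qm] at huv
    have h1 := hs u hu
    have h2 := hs v hv
    have h3 : (u - v) * (u + v) = 0 := by linarith
    rcases mul_eq_zero.1 h3 with h4 | h4
    · linarith
    · have : u = -v := by linarith
      subst this
      nlinarith [h1.1, h2.1]
  · intro u hu
    have h1 := hs u hu
    simp only [qm]
    rw [mem_uIcc] at hu ⊢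
    rcases mul_pos_iff.1 h with ⟨h3, h4⟩ | ⟨h3, h4⟩
    · have hu0 : 0 < u := by nlinarith
      rcases hu with ⟨h5, h6⟩ | ⟨h5, h6⟩
      · right; constructor <;> nlinarith
      · left; constructor <;> nlinarith
    · have hu0 : u < 0 := by nlinarith
      rcases hu with ⟨h5, h6⟩ | ⟨h5, h6⟩
      · left; constructor <;> nlinarith
      · right; constructor <;> nlinarith

lemma orbit_add_period {a : ℝ} {m p : ℕ} (hper : (qm a)^[m + p] 0 = (qm a)^[m] 0) {i : ℕ}
    (hi : m ≤ i) : (qm a)^[i + p] 0 = (qm a)^[i] 0 := by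
  obtain ⟨k, rfl⟩ := Nat.exists_eq_add_of_le hi
  rw [show m + k + p = k + (m + p) by ring, show m + k = k + m by ring,
    Function.iterate_add_apply, hper, ← Function.iterate_add_apply]

/-- The cycle on which a strictly preperiodic critical point lands is repelling. -/
lemma critical_cycle_repelling {a : ℝ} (ha : a ≤ 2) (hbd : ∀ i, |(qm a)^[i] 0| < 2)
    (h0 : ∀ i : ℕ, 1 ≤ i → (qm a)^[i] 0 ≠ 0) {m p : ℕ} (hm : 1 ≤ m) (hp : 1 ≤ p)
    (hper : (qm a)^[m + p] 0 = (qm a)^[m] 0) :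
    1 < ∏ i ∈ Finset.range p, (2 * |(qm a)^[m + i] 0|) := by
  by_contra! hΛ
  set c : ℕ → ℝ := fun i => (qm a)^[i] 0 with hc
  have hperc : ∀ i, m ≤ i → c (i + p) = c i := fun i hi => orbit_add_period hper hi
  have hcs : ∀ i, c (i + 1) = a - c i ^ 2 := by
    intro i
    simp only [hc, Function.iterate_succ_apply', qm]
  have hpermul : ∀ k i, m ≤ i → c (i + k * p) = c i := by
    intro k i hi
    induction k with
    | zero => simp
    | succ k ih => rw [Nat.succ_mul, ← add_assoc, hperc _ (by omega), ih]
  set z : ℕ → ℝ := fun k => c (m + k * (p - 1)) with hz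
  have hzs : ∀ k, a - z (k + 1) ^ 2 = z k := by
    intro k
    simp only [hz]
    rw [← hcs, show m + (k + 1) * (p - 1) + 1 = m + k * (p - 1) + p by
      rw [Nat.succ_mul]; omega, hperc _ (by omega)]
  have hz0 : ∀ k, z k ≠ 0 := fun k => h0 _ (by omega)
  have hzp : ∀ k, z (k + p) = z k := by
    intro k
    simp only [hz]
    rw [show m + (k + p) * (p - 1) = m + k * (p - 1) + (p - 1) * p by ring]
    exact hpermul _ _ (by omega)
  have hza : ∀ k, z k ≠ a := by
    intro k hk
    have := hzs k
    have h2 : z (k + 1) ^ 2 = 0 := by linarith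
    exact hz0 (k + 1) (by simpa using h2)
  set G : ℕ → ℝ := fun k => ∏ j ∈ Finset.range k, (2 * |z (j + 1)|) with hG
  have hGpos : ∀ k, 0 < G k := fun k => Finset.prod_pos fun j _ =>
    mul_pos two_pos (abs_pos.2 (hz0 _))
  have hGp : ∀ k, G (k + p) ≤ G k := by
    intro k
    have e : G (k + p) = G k * ∏ i ∈ Finset.range p, (2 * |c (m + i)|) := by
      simp only [hG]
      rw [Finset.prod_range_add]
      congr 1
      have := prod_range_add_of_periodic (fun j => 2 * |z (j + 1)|) p
        (fun i => by
          have := hzp (i + 1)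
          rw [show i + 1 + p = i + p + 1 by ring] at this
          simp only [this]) k
      rw [this, ← Finset.prod_range_reflect (fun i => 2 * |c (m + i)|) p]
      refine Finset.prod_congr rfl fun j hj => ?_
      have hj' := Finset.mem_range.1 hj
      simp only [hz]
      rw [← hpermul j (m + (p - 1 - j)) (by omega)]
      congr 3
      obtain ⟨r, rfl⟩ : ∃ r, p = j + 1 + r := ⟨p - (j + 1), by omega⟩
      simp only [show j + 1 + r - 1 = j + r by omega, show j + r - j = r by omega]
      ring
    rw [e]
    exact mul_le_of_le_one_right (hGpos k).le hΛ
  obtain ⟨Gm, hGm⟩ : ∃ Gm, ∀ k, G k ≤ Gm := by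
    refine ⟨∑ k ∈ Finset.range p, G k, fun k => ?_⟩
    have h1 : ∀ s r, G (r + s * p) ≤ G r := by
      intro s r
      induction s with
      | zero => simp
      | succ s ih => rw [Nat.succ_mul, ← add_assoc]; exact (hGp _).trans ih
    have h2 := h1 (k / p) (k % p)
    rw [mul_comm, Nat.mod_add_div] at h2
    exact h2.trans (Finset.single_le_sum (fun i _ => (hGpos i).le)
      (Finset.mem_range.2 (Nat.mod_lt _ hp)))
  have hGm0 : 0 < Gm := (hGpos 0).trans_le (hGm 0)
  -- a punctured neighbourhood of the cycle point free of the critical orbit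
  obtain ⟨δ, hδ0, hδ2, hδ⟩ : ∃ δ > 0, |z 0| + δ ≤ 2 ∧
      ∀ i, c i ∈ Icc (z 0 - δ) (z 0 + δ) → c i = z 0 := by
    have hfin : (range c).Finite := by
      refine (Set.finite_range (fun i : Fin (m + p) => c i)).subset ?_
      rintro _ ⟨i, rfl⟩
      by_cases hi : i < m + p
      · exact ⟨⟨i, hi⟩, rfl⟩
      · refine ⟨⟨m + (i - m) % p, by
          have := Nat.mod_lt (i - m) hp; omega⟩, ?_⟩
        simp only
        rw [← hpermul ((i - m) / p) _ (by omega), add_assoc, Nat.mul_comm _ p, Nat.mod_add_div]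
        congr 1
        omega
    have hcl : IsClosed (range c \ {z 0}) := (hfin.subset sdiff_subset).isClosed
    have hmem : (range c \ {z 0})ᶜ ∈ nhds (z 0) := hcl.isOpen_compl.mem_nhds (by simp)
    obtain ⟨ε, hε, hsub⟩ := Metric.mem_nhds_iff.1 hmem
    refine ⟨min (ε / 2) (2 - |z 0|), lt_min (by linarith) (by linarith [hbd (m + 0 * (p - 1))]),
      by linarith [min_le_right (ε / 2) (2 - |z 0|)], fun i hi => ?_⟩
    by_contra hne
    refine hsub (a := c i) ?_ ⟨⟨i, rfl⟩, hne⟩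
    rw [Metric.mem_ball, Real.dist_eq, abs_lt]
    have := min_le_left (ε / 2) (2 - |z 0|)
    constructor <;> linarith [hi.1, hi.2]
  set V : ℝ := 2 / δ
  set κ : ℝ := (1 / (Gm * V)) ^ 2 / 16
  have hV : 0 < V := by positivity
  have hκ : 0 < κ := by positivity
  have main : ∀ k, ∃ x y : ℝ, (x - z k) * (y - z k) < 0 ∧ |x| ≤ 2 ∧ |y| ≤ 2 ∧
      InjOn (qm a)^[k] (uIcc x y) ∧
      MapsTo (qm a)^[k] (uIcc x y) (Icc (z 0 - δ) (z 0 + δ)) ∧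
      (qm a)^[k] (z k) = z 0 ∧
      (1 / |x - z k| + 1 / |y - z k|) * (1 + κ) ^ k ≤ G k * V := by
    intro k
    induction k with
    | zero =>
      refine ⟨z 0 - δ, z 0 + δ, by nlinarith, ?_, ?_, ?_, ?_, by simp, ?_⟩
      · rw [abs_le] at *
        constructor <;> linarith [neg_abs_le (z 0), le_abs_self (z 0)]
      · rw [abs_le] at *
        constructor <;> linarith [neg_abs_le (z 0), le_abs_self (z 0)]
      · simp
      · rw [uIcc_of_le (by linarith)]; exact mapsTo_id _
      · simp only [hG, V, Finset.range_zero, Finset.prod_empty, pow_zero, sub_sub_cancel_left,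
          add_sub_cancel_left, abs_neg, abs_of_pos hδ0]
        apply le_of_eq; ring
    | succ k ih =>
      obtain ⟨x, y, hxy, hx2, hy2, hinj, hmaps, hzk, hineq⟩ := ih
      have hzmem : z k ∈ uIcc x y := by
        rw [mem_uIcc]
        rcases mul_neg_iff.1 hxy with ⟨h1, h2⟩ | ⟨h1, h2⟩
        · right; constructor <;> linarith
        · left; constructor <;> linarith
      have ha' : a ∉ uIcc x y := by
        intro hmem
        have h1 : (qm a)^[k] a = c (k + 1) := by
          simp [hc, Function.iterate_succ_apply, qm]
        have h2 := hmaps hmem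
        rw [h1] at h2
        have h3 := hδ _ h2
        exact hza k (hinj hzmem hmem (by rw [hzk, h1, h3]))
      have hzlt : z k < a := lt_of_le_of_ne (by rw [← hzs k]; nlinarith [sq_nonneg (z (k + 1))])
        (hza k)
      have hxa : x < a := by
        by_contra! h
        exact ha' ((ordConnected_uIcc.out hzmem left_mem_uIcc) ⟨hzlt.le, h⟩)
      have hya : y < a := by
        by_contra! h
        exact ha' ((ordConnected_uIcc.out hzmem right_mem_uIcc) ⟨hzlt.le, h⟩)
      obtain ⟨x', y', hs, hx', hy', hxy', hx2', hy2', hin⟩ :=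
        pullback_step ha (hz0 (k + 1)) (hzs k) hxy hxa hya hx2 hy2
      obtain ⟨hi1, hm1⟩ := qm_injOn_mapsTo_uIcc a hs
      have hm2 : MapsTo (qm a) (uIcc x' y') (uIcc x y) := by
        have e1 : qm a x' = x := hx'
        have e2 : qm a y' = y := hy'
        rwa [e1, e2] at hm1
      refine ⟨x', y', hxy', hx2', hy2', hinj.comp hi1 hm2, hmaps.comp hm2, ?_, ?_⟩
      · rw [Function.iterate_succ_apply]
        have : qm a (z (k + 1)) = z k := hzs k
        rw [this, hzk]
      · have hGs : G (k + 1) = G k * (2 * |z (k + 1)|) := Finset.prod_range_succ _ _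
        set P := |x' - z (k + 1)|
        set Q := |y' - z (k + 1)|
        have hP : 0 < P := abs_pos.2 fun h => by rw [h] at hxy'; simp at hxy'
        have hQ : 0 < Q := abs_pos.2 fun h => by rw [h] at hxy'; simp at hxy'
        have hk1 : (1 : ℝ) ≤ (1 + κ) ^ k := one_le_pow₀ (by linarith)
        have step : (1 / P + 1 / Q) * (1 + P * Q / 16) * (1 + κ) ^ k ≤ G (k + 1) * V := by
          calc _ ≤ 2 * |z (k + 1)| * (1 / |x - z k| + 1 / |y - z k|) * (1 + κ) ^ k := by gcongr
            _ = 2 * |z (k + 1)| * ((1 / |x - z k| + 1 / |y - z k|) * (1 + κ) ^ k) := by ring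
            _ ≤ 2 * |z (k + 1)| * (G k * V) := by gcongr
            _ = _ := by rw [hGs]; ring
        have hb : 1 / P + 1 / Q ≤ Gm * V := by
          have h1 : (1 / P + 1 / Q) * 1 * 1 ≤ (1 / P + 1 / Q) * (1 + P * Q / 16) * (1 + κ) ^ k := by
            gcongr
            have : 0 < P * Q := by positivity
            linarith
          have h2 : G (k + 1) * V ≤ Gm * V := by gcongr; exact hGm _
          linarith
        have hP' : 1 / (Gm * V) ≤ P := by
          rw [one_div_le (by positivity) hP]
          have : 0 < 1 / Q := by positivity
          linarith
        have hQ' : 1 / (Gm * V) ≤ Q := by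
          rw [one_div_le (by positivity) hQ]
          have : 0 < 1 / P := by positivity
          linarith
        have hκ' : κ ≤ P * Q / 16 := by
          simp only [κ]
          rw [sq]
          gcongr
        calc (1 / P + 1 / Q) * (1 + κ) ^ (k + 1)
            = (1 / P + 1 / Q) * (1 + κ) * (1 + κ) ^ k := by ring
          _ ≤ (1 / P + 1 / Q) * (1 + P * Q / 16) * (1 + κ) ^ k := by gcongr
          _ ≤ _ := step
  obtain ⟨k, hk⟩ := pow_unbounded_of_one_lt (2 * (Gm * V)) (by linarith : 1 < 1 + κ)
  obtain ⟨x, y, hxy, hx2, hy2, -, -, -, h⟩ := main k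
  have hz2 : |z k| ≤ 2 := (hbd _).le
  have hne : x - z k ≠ 0 := fun h => by rw [h] at hxy; simp at hxy
  have h4 : |x - z k| ≤ 4 := (abs_sub _ _).trans (by linarith)
  have h4' : |y - z k| ≤ 4 := (abs_sub _ _).trans (by linarith)
  have hne' : y - z k ≠ 0 := fun h => by rw [h] at hxy; simp at hxy
  have h5 : 1 / 4 ≤ 1 / |x - z k| := one_div_le_one_div_of_le (abs_pos.2 hne) h4
  have h6 : 1 / 4 ≤ 1 / |y - z k| := one_div_le_one_div_of_le (abs_pos.2 hne') h4'
  have h7 : (1 / 2) * (1 + κ) ^ k ≤ Gm * V := by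
    calc (1 / 2) * (1 + κ) ^ k ≤ (1 / |x - z k| + 1 / |y - z k|) * (1 + κ) ^ k := by
          gcongr; linarith
      _ ≤ G k * V := h
      _ ≤ _ := by gcongr; exact hGm k
  linarith

/-! ### The series `∑ φ(dⁱθ) / Eᵢ` -/

lemma analyticAt_zero_of_rescaling {Φ U : ℝ → ℝ} {q Λ L : ℝ} (hΦ : AnalyticAt ℝ Φ 0)
    (hq : 1 < q) (hΛ0 : Λ ≠ 0) (hΛq : |Λ| < q) (hU : ∀ t, U t = Φ t + U (q * t) / Λ)
    (hL : ∀ t, |t| ≤ 1 / 2 → |U t - U 0| ≤ L * |t|) : AnalyticAt ℝ U 0 := by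
  obtain ⟨P, hP⟩ := hΦ
  obtain ⟨C, r, hC, hr, hCr⟩ := P.le_mul_pow_of_radius_pos hP.radius_pos
  have hq0 : 0 < q := by linarith
  have hden : ∀ s : ℕ, 1 ≤ s → q - |Λ| ≤ |Λ - q ^ s| := by
    intro s hs
    have h1 : q ≤ q ^ s := le_self_pow₀ hq.le (by omega)
    have h2 := abs_sub_abs_le_abs_sub (q ^ s) Λ
    rw [abs_sub_comm, abs_of_pos (by positivity : 0 < q ^ s)] at h2
    linarith
  set v : ℕ → ℝ := fun s => if s = 0 then 0 else P.coeff s * Λ / (Λ - q ^ s) with hv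
  set K : ℝ := C * |Λ| / (q - |Λ|)
  have hqL : 0 < q - |Λ| := by linarith
  have hK : 0 ≤ K := by positivity
  have ha : ∀ s, |P.coeff s| ≤ C * r ^ s := by
    intro s
    have := hCr s
    rwa [FormalMultilinearSeries.norm_apply_eq_norm_coef, Real.norm_eq_abs] at this
  have hvb : ∀ s, |v s| ≤ K * r ^ s := by
    intro s
    by_cases hs : s = 0
    · simp [hv, hs, hK]
    · simp only [hv, hs, if_false, abs_div, abs_mul]
      rw [show K * r ^ s = C * r ^ s * |Λ| / (q - |Λ|) by simp only [K]; ring]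
      gcongr
      · exact ha s
      · exact hden s (Nat.one_le_iff_ne_zero.2 hs)
  have hsum : ∀ t : ℝ, r * |t| < 1 → Summable fun s => t ^ s * v s := by
    intro t ht
    refine Summable.of_norm_bounded (g := fun s => K * (r * |t|) ^ s)
      ((summable_geometric_of_lt_one (by positivity) ht).mul_left K) fun s => ?_
    rw [Real.norm_eq_abs, abs_mul, abs_pow, mul_pow]
    calc |t| ^ s * |v s| ≤ |t| ^ s * (K * r ^ s) := by gcongr; exact hvb s
      _ = _ := by ring
  set V : ℝ → ℝ := fun t => ∑' s, t ^ s * v s with hV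
  have hVan : AnalyticAt ℝ V 0 := by
    refine ⟨FormalMultilinearSeries.ofScalars ℝ v, ?_⟩
    rw [hasFPowerSeriesAt_iff]
    have : ∀ᶠ t : ℝ in nhds 0, r * |t| < 1 :=
      (by fun_prop : Continuous fun t : ℝ => r * |t|).continuousAt.eventually_lt
        continuousAt_const (by simp)
    filter_upwards [this] with t ht
    simpa [FormalMultilinearSeries.coeff_ofScalars, hV] using (hsum t ht).hasSum
  have hV0 : V 0 = 0 := by
    simp only [hV]
    rw [tsum_eq_single 0 (fun s hs => by simp [hs])]
    simp [hv]
  have hΦ0 : Φ 0 = P.coeff 0 :=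
    (hP.coeff_zero 1).symm
  have hfun : ∀ᶠ t : ℝ in nhds 0, V t = Φ t - Φ 0 + V (q * t) / Λ := by
    have h1 : ∀ᶠ t : ℝ in nhds 0, r * |q * t| < 1 :=
      (by fun_prop : Continuous fun t : ℝ => r * |q * t|).continuousAt.eventually_lt
        continuousAt_const (by simp)
    have h2 := hasFPowerSeriesAt_iff.1 hP
    filter_upwards [h1, h2] with t h1 h2
    simp only [zero_add, smul_eq_mul] at h2
    have h4 : r * |t| < 1 := by
      refine lt_of_le_of_lt ?_ h1
      refine mul_le_mul_of_nonneg_left ?_ hr.le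
      rw [abs_mul, abs_of_pos hq0]
      exact le_mul_of_one_le_left (abs_nonneg _) hq.le
    have h5 := (hsum t h4).hasSum
    have h6 := ((hsum (q * t) h1).hasSum).div_const Λ
    have h7 := (h2.sub (hasSum_ite_eq (0 : ℕ) (Φ 0))).add h6
    refine h5.unique ?_
    suffices e : (fun s => t ^ s * v s) = fun s => t ^ s * P.coeff s -
        (if s = 0 then Φ 0 else 0) + (q * t) ^ s * v s / Λ by
      rw [e]; exact h7
    funext s
    by_cases hs : s = 0
    · subst hs; simp [hv, hΦ0]
    · have : Λ - q ^ s ≠ 0 := by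
        intro h
        have := hden s (Nat.one_le_iff_ne_zero.2 hs)
        rw [h, abs_zero] at this
        linarith
      simp only [hv, hs, if_false]
      field_simp
      ring
  obtain ⟨L', hL'⟩ := (hVan.differentiableAt.isBigO_sub).bound
  have hall : ∀ᶠ t : ℝ in nhds 0, V t = Φ t - Φ 0 + V (q * t) / Λ ∧ |V t| ≤ L' * |t| := by
    filter_upwards [hfun, hL'] with t h1 h2
    exact ⟨h1, by simpa [hV0] using h2⟩
  obtain ⟨ε, hε, hball⟩ := Metric.eventually_nhds_iff.1 hall
  set W : ℝ → ℝ := fun t => U t - U 0 - V t with hW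
  have hΛpos : 0 < |Λ| := abs_pos.2 hΛ0
  have hWzero : ∀ t : ℝ, |t| < min ε (1 / 2) → W t = 0 := by
    intro t ht
    have hsmall : ∀ k : ℕ, |t / q ^ k| = |t| / q ^ k ∧ |t / q ^ k| < min ε (1 / 2) := by
      intro k
      have e : |t / q ^ k| = |t| / q ^ k := by
        rw [abs_div, abs_of_pos (by positivity : 0 < q ^ k)]
      exact ⟨e, by rw [e]; exact (div_le_self (abs_nonneg _) (one_le_pow₀ hq.le)).trans_lt ht⟩
    have hit : ∀ k : ℕ, W t = Λ ^ k * W (t / q ^ k) := by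
      intro k
      induction k with
      | zero => simp
      | succ k ih =>
        rw [ih]
        have e : q * (t / q ^ (k + 1)) = t / q ^ k := by field_simp; ring
        have h1 := (hball (y := t / q ^ (k + 1)) (by
          rw [Real.dist_eq, sub_zero]; exact (hsmall _).2.trans_le (min_le_left _ _))).1
        have h2 := hU (t / q ^ (k + 1))
        have h3 := hU 0
        rw [mul_zero] at h3
        rw [e] at h1 h2
        have : W (t / q ^ k) = Λ * W (t / q ^ (k + 1)) := by
          simp only [hW]
          rw [h1, h2]
          field_simp
          field_simp at h3
          linear_combination h3
        rw [this]; ring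
    have hb : ∀ k : ℕ, |W t| ≤ (L + L') * |t| * (|Λ| / q) ^ k := by
      intro k
      have h1 := (hball (y := t / q ^ k) (by
          rw [Real.dist_eq, sub_zero]; exact (hsmall _).2.trans_le (min_le_left _ _))).2
      have h2 := hL (t / q ^ k) ((hsmall _).2.le.trans (min_le_right _ _))
      rw [hit k, abs_mul, abs_pow]
      have h3 : |W (t / q ^ k)| ≤ (L + L') * |t / q ^ k| :=
        (abs_sub _ _).trans (by linarith)
      calc |Λ| ^ k * |W (t / q ^ k)| ≤ |Λ| ^ k * ((L + L') * |t / q ^ k|) := by gcongr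
        _ = _ := by rw [(hsmall k).1, div_pow]; ring
    have hlim : Tendsto (fun k : ℕ => (L + L') * |t| * (|Λ| / q) ^ k) atTop (nhds 0) := by
      have := (tendsto_pow_atTop_nhds_zero_of_lt_one (by positivity)
        ((div_lt_one hq0).2 hΛq)).const_mul ((L + L') * |t|)
      simpa using this
    exact abs_eq_zero.1 (le_antisymm (ge_of_tendsto' hlim hb) (abs_nonneg _))
  have hVU : AnalyticAt ℝ (fun t => U 0 + V t) 0 := analyticAt_const.add hVan
  refine hVU.congr ?_
  rw [EventuallyEq, Metric.eventually_nhds_iff]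
  refine ⟨min ε (1 / 2), by positivity, fun t ht => ?_⟩
  rw [Real.dist_eq, sub_zero] at ht
  have := hWzero t ht
  simp only [hW] at this
  linarith

lemma analyticAt_of_rescaling {Φ U : ℝ → ℝ} {q Λ L : ℝ} (hΦ : ∀ t, AnalyticAt ℝ Φ t)
    (hq : 1 < q) (hΛ0 : Λ ≠ 0) (hΛq : |Λ| < q) (hU : ∀ t, U t = Φ t + U (q * t) / Λ)
    (hL : ∀ t, |t| ≤ 1 / 2 → |U t - U 0| ≤ L * |t|) (t : ℝ) : AnalyticAt ℝ U t := by
  have h0 := analyticAt_zero_of_rescaling (hΦ 0) hq hΛ0 hΛq hU hL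
  have hq0 : 0 < q := by linarith
  obtain ⟨r, hr, hball⟩ := Metric.eventually_nhds_iff.1 h0.eventually_analyticAt
  have key : ∀ (k : ℕ) (t : ℝ), |t| < r * q ^ k → AnalyticAt ℝ U t := by
    intro k
    induction k with
    | zero => intro t ht; exact hball (by simpa using ht)
    | succ k ih =>
      intro t ht
      have h1 : |t / q| < r * q ^ k := by
        rw [abs_div, abs_of_pos hq0, div_lt_iff₀ hq0]
        rw [pow_succ] at ht; linarith
      have e : U = fun t => Λ * (U (t / q) - Φ (t / q)) := by
        funext t
        have := hU (t / q)
        rw [mul_div_cancel₀ _ hq0.ne'] at this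
        rw [this]; field_simp; ring
      rw [e]
      have hdiv : AnalyticAt ℝ (fun t : ℝ => t / q) t := by fun_prop
      exact analyticAt_const.mul
        ((AnalyticAt.fun_comp (g := U) (f := fun t => t / q) (ih _ h1) hdiv).sub
          (AnalyticAt.fun_comp (g := Φ) (f := fun t => t / q) (hΦ _) hdiv))
  obtain ⟨k, hk⟩ := pow_unbounded_of_one_lt (|t| / r) hq
  exact key k t (by rw [div_lt_iff₀ hr] at hk; linarith)

/-- The Weierstrass-type series `∑ φ(dⁱθ) / Eᵢ`. -/
def tser (φ : ℝ → ℝ) (d : ℕ) (E : ℕ → ℝ) (θ : ℝ) : ℝ := ∑' i, φ ((d : ℝ) ^ i * θ) / E i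

lemma exists_lipschitz_of_periodic {φ : ℝ → ℝ} (hφa : ∀ x : ℝ, AnalyticAt ℝ φ x)
    (hφp : Function.Periodic φ 1) : ∃ L : ℝ, 0 ≤ L ∧ ∀ x y, |φ x - φ y| ≤ L * |x - y| := by
  have hd : ∀ x, DifferentiableAt ℝ φ x := fun x => (hφa x).differentiableAt
  have hc : Continuous (deriv φ) :=
    continuous_iff_continuousAt.2 fun x => (hφa x).deriv.continuousAt
  have hper : Function.Periodic (deriv φ) 1 := by
    intro x
    have : (fun y => φ (y + 1)) = φ := funext hφp
    rw [← deriv_comp_add_const, this]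
  obtain ⟨C, hC⟩ := isCompact_Icc.exists_bound_of_continuousOn (s := Icc (0 : ℝ) 1) hc.continuousOn
  have hb : ∀ x, ‖deriv φ x‖ ≤ C := by
    intro x
    obtain ⟨y, hy, hxy⟩ := hper.exists_mem_Ico₀ one_pos x
    rw [hxy]
    exact hC y ⟨hy.1, hy.2.le⟩
  refine ⟨C, (norm_nonneg _).trans (hb 0), fun x y => ?_⟩
  exact Convex.norm_image_sub_le_of_norm_deriv_le (fun x _ => hd x) (fun x _ => hb x) convex_univ
    (mem_univ y) (mem_univ x)

section series

variable {φ : ℝ → ℝ} {d : ℕ} {E : ℕ → ℝ}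

lemma tser_term_bound (hφb : ∀ θ : ℝ, |φ θ| ≤ 1) (θ : ℝ) (i : ℕ) :
    ‖φ ((d : ℝ) ^ i * θ) / E i‖ ≤ 1 / |E i| := by
  rw [Real.norm_eq_abs, abs_div]
  gcongr
  exact hφb _

lemma tser_summable (hφb : ∀ θ : ℝ, |φ θ| ≤ 1) (hE : Summable fun i => 1 / |E i|) (θ : ℝ) :
    Summable fun i => φ ((d : ℝ) ^ i * θ) / E i :=
  Summable.of_norm_bounded hE (tser_term_bound hφb θ)

lemma tser_continuous (hφc : Continuous φ) (hφb : ∀ θ : ℝ, |φ θ| ≤ 1)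
    (hE : Summable fun i => 1 / |E i|) : Continuous (tser φ d E) :=
  continuous_tsum (fun i => by fun_prop) hE fun i θ => tser_term_bound hφb θ i

lemma tser_add_int (hφp : Function.Periodic φ 1) (θ : ℝ) (k : ℤ) :
    tser φ d E (θ + k) = tser φ d E θ := by
  unfold tser
  congr 1
  funext i
  congr 1
  have := (hφp.int_mul ((d : ℤ) ^ i * k)) ((d : ℝ) ^ i * θ)
  rw [← this]
  congr 1
  push_cast
  ring

lemma tser_split (hφb : ∀ θ : ℝ, |φ θ| ≤ 1) (hE : Summable fun i => 1 / |E i|) (n : ℕ) (θ : ℝ) :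
    tser φ d E θ = ∑ i ∈ Finset.range n, φ ((d : ℝ) ^ i * θ) / E i +
      tser φ d (fun i => E (n + i)) ((d : ℝ) ^ n * θ) := by
  unfold tser
  rw [← (tser_summable hφb hE θ).sum_add_tsum_nat_add n]
  congr 1
  congr 1
  funext i
  rw [add_comm i n, pow_add]
  congr 2
  ring

/-- A constant series forces `φ` to be constant. -/
lemma const_of_tser_const (hd : 2 ≤ d) (hφc : Continuous φ) (hφp : Function.Periodic φ 1)
    (hφb : ∀ θ : ℝ, |φ θ| ≤ 1) (hE : Summable fun i => 1 / |E i|) (hE0 : E 0 ≠ 0)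
    {v : ℝ} (hv : ∀ θ, tser φ d E θ = v) (s t : ℝ) : φ s = φ t := by
  have hd0 : (0 : ℝ) < d := by positivity
  have hper : ∀ k : ℕ, Function.Periodic φ (1 / (d : ℝ) ^ k) := by
    intro k
    induction k with
    | zero => simpa using hφp
    | succ k ih =>
      intro θ
      have h1 := tser_split (d := d) hφb hE 1 (θ + 1 / (d : ℝ) ^ (k + 1))
      have h2 := tser_split (d := d) hφb hE 1 θ
      rw [hv] at h1 h2
      have h3 : tser φ d (fun i => E (1 + i)) ((d : ℝ) ^ 1 * (θ + 1 / (d : ℝ) ^ (k + 1))) =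
          tser φ d (fun i => E (1 + i)) ((d : ℝ) ^ 1 * θ) := by
        unfold tser
        congr 1
        funext i
        congr 1
        have := (ih.nat_mul (d ^ i)) ((d : ℝ) ^ i * ((d : ℝ) ^ 1 * θ))
        rw [← this]
        congr 1
        push_cast
        field_simp
        ring
      rw [h3] at h1
      simp only [Finset.range_one, Finset.sum_singleton, pow_zero, one_mul] at h1 h2
      have h4 : φ (θ + 1 / (d : ℝ) ^ (k + 1)) / E 0 = φ θ / E 0 := by linarith
      exact (div_left_inj' hE0).1 h4
  have hzero : ∀ s, φ s = φ 0 := by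
    intro s
    set w : ℕ → ℝ := fun k => s - ⌊s * (d : ℝ) ^ k⌋ * (1 / (d : ℝ) ^ k)
    have hw : ∀ k, φ (w k) = φ s := fun k => ((hper k).int_mul _).sub_eq s
    have hlim : Tendsto w atTop (nhds 0) := by
      have hg : Tendsto (fun k : ℕ => (1 / (d : ℝ)) ^ k) atTop (nhds 0) :=
        tendsto_pow_atTop_nhds_zero_of_lt_one (by positivity)
          (by rw [div_lt_one hd0]; exact_mod_cast hd)
      refine squeeze_zero (fun k => ?_) (fun k => ?_) hg
      · have := Int.floor_le (s * (d : ℝ) ^ k)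
        simp only [w]
        rw [mul_one_div, sub_nonneg, div_le_iff₀ (by positivity)]
        exact this
      · have := (Int.lt_floor_add_one (s * (d : ℝ) ^ k)).le
        simp only [w]
        rw [one_div_pow, mul_one_div, sub_le_iff_le_add, ← add_div, le_div_iff₀ (by positivity)]
        linarith
    have := (hφc.tendsto 0).comp hlim
    exact tendsto_nhds_unique (by simp [Function.comp_def, hw] :
      Tendsto (φ ∘ w) atTop (nhds (φ s))) this
  rw [hzero s, hzero t]

end series

/-- At almost every point `x` of `S`, the set `S` comes proportionally close to any prescribed
sequence of points which are at distance comparable to a scale tending to `0`. -/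
lemma ae_exists_mem_near (S : Set ℝ) : ∀ᵐ x ∂(volume.restrict S), ∀ ε : ℝ, 0 < ε →
    ∀ (δ : ℕ → ℝ) (h : ℕ → ℝ), Tendsto δ atTop (nhds 0) → (∀ n, 0 < δ n) → (∀ n, |h n| ≤ 1) →
      ∀ᶠ n in atTop, ∃ h', |h' - h n| ≤ ε ∧ x + δ n * h' ∈ S := by
  have key := ae_all_iff.2 fun k : ℕ =>
    IsUnifLocDoublingMeasure.ae_tendsto_measure_inter_div (volume : Measure ℝ) S (k + 1 : ℝ)
  filter_upwards [key] with x hx ε hε δ h hδ hδ0 hh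
  obtain ⟨k, hk⟩ := exists_nat_one_div_lt hε
  have hk0 : (0 : ℝ) < k + 1 := by positivity
  have hlim : Tendsto (fun n => (1 / ((k : ℝ) + 1)) * δ n) atTop (nhdsWithin 0 (Ioi 0)) := by
    refine tendsto_nhdsWithin_iff.2 ⟨by simpa using hδ.const_mul (1 / ((k : ℝ) + 1)), ?_⟩
    exact Eventually.of_forall fun n => mul_pos (by positivity) (hδ0 n)
  have := hx k (fun n => x + δ n * h n) _ hlim (Eventually.of_forall fun n => by
    rw [Metric.mem_closedBall, Real.dist_eq, ← mul_assoc, mul_one_div_cancel hk0.ne', one_mul,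
      sub_add_cancel_left, abs_neg, abs_mul, abs_of_pos (hδ0 n)]
    exact mul_le_of_le_one_right (hδ0 n).le (hh n))
  have h2 := this.eventually (lt_mem_nhds (zero_lt_one))
  filter_upwards [h2] with n hn
  have hne : (S ∩ Metric.closedBall (x + δ n * h n) (1 / ((k : ℝ) + 1) * δ n)).Nonempty := by
    by_contra hcon
    rw [not_nonempty_iff_eq_empty.1 hcon] at hn
    simp at hn
  obtain ⟨y, hyS, hy⟩ := hne
  refine ⟨(y - x) / δ n, ?_, ?_⟩
  · rw [Metric.mem_closedBall, Real.dist_eq] at hy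
    have e : (y - x) / δ n - h n = (y - (x + δ n * h n)) / δ n := by
      have := (hδ0 n).ne'
      field_simp
      ring
    rw [e, abs_div, abs_of_pos (hδ0 n), div_le_iff₀ (hδ0 n)]
    exact hy.trans (by have := hδ0 n; gcongr)
  · rw [mul_div_cancel₀ _ (hδ0 n).ne', add_sub_cancel]
    exact hyS

section levelsets

variable {φ : ℝ → ℝ} {d m p : ℕ} {E : ℕ → ℝ} {Λ : ℝ}

lemma mul_pow_of_periodic (hper : ∀ i, m ≤ i → E (i + p) = Λ * E i) (s i : ℕ) :
    E (m + s * p + i) = Λ ^ s * E (m + i) := by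
  induction s with
  | zero => simp
  | succ s ih =>
    rw [show m + (s + 1) * p + i = m + s * p + i + p by ring, hper _ (by omega), ih]
    ring

lemma tser_const_mul (c : ℝ) (θ : ℝ) :
    tser φ d (fun i => c * E i) θ = tser φ d E θ / c := by
  unfold tser
  rw [← tsum_div_const]
  congr 1
  funext i
  dsimp only
  rw [div_div, mul_comm c (E i)]

/-- The geometric bound for the Lipschitz constants of the partial sums. -/
lemma partial_lipschitz_bound (hΛ0 : 0 < |Λ|) (hΛq : |Λ| < (d : ℝ) ^ p)
    (hper : ∀ i, m ≤ i → E (i + p) = Λ * E i) : ∃ K : ℝ, 0 ≤ K ∧ ∀ s : ℕ,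
      ∑ i ∈ Finset.range (m + s * p), (d : ℝ) ^ i / |E i| ≤ K * ((d : ℝ) ^ p / |Λ|) ^ s := by
  set ρ : ℝ := (d : ℝ) ^ p / |Λ|
  have hρ : 1 < ρ := (one_lt_div hΛ0).2 hΛq
  set B : ℝ := ∑ i ∈ Finset.range m, (d : ℝ) ^ i / |E i|
  set D : ℝ := ∑ i ∈ Finset.range p, (d : ℝ) ^ (m + i) / |E (m + i)|
  have hB : 0 ≤ B := Finset.sum_nonneg fun i _ => by positivity
  have hD : 0 ≤ D := Finset.sum_nonneg fun i _ => by positivity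
  have hρ1 : 0 < ρ - 1 := by linarith
  refine ⟨B + D / (ρ - 1), by positivity, fun s => ?_⟩
  induction s with
  | zero => simp only [zero_mul, add_zero, pow_zero, mul_one]; exact le_add_of_nonneg_right (by positivity)
  | succ s ih =>
    have e : ∑ i ∈ Finset.range p, (d : ℝ) ^ (m + s * p + i) / |E (m + s * p + i)| = ρ ^ s * D := by
      rw [Finset.mul_sum]
      refine Finset.sum_congr rfl fun i _ => ?_
      rw [mul_pow_of_periodic hper, abs_mul, abs_pow]
      simp only [ρ]
      rw [div_pow, ← pow_mul, show m + s * p + i = p * s + (m + i) by ring, pow_add,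
        mul_div_mul_comm]
    rw [show m + (s + 1) * p = m + s * p + p by ring, Finset.sum_range_add, e]
    have h1 : (B + D / (ρ - 1)) * ρ ^ (s + 1) =
        (B + D / (ρ - 1)) * ρ ^ s + (ρ ^ s * D + B * (ρ - 1) * ρ ^ s) := by
      field_simp
      ring
    rw [h1]
    have : 0 ≤ B * (ρ - 1) * ρ ^ s := by positivity
    linarith

/-- The level sets of the series are null sets. -/
lemma volume_tser_level (hd : 2 ≤ d) (hφa : ∀ x : ℝ, AnalyticAt ℝ φ x)
    (hφp : Function.Periodic φ 1) (hφnc : ∃ s t : ℝ, φ s ≠ φ t) (hφb : ∀ θ : ℝ, |φ θ| ≤ 1)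
    (hE : Summable fun i => 1 / |E i|) (hE0 : ∀ i, E i ≠ 0) (hp : 1 ≤ p) (hΛ0 : 0 < |Λ|)
    (hΛq : |Λ| < (d : ℝ) ^ p) (hper : ∀ i, m ≤ i → E (i + p) = Λ * E i) (v : ℝ) :
    volume ({θ | tser φ d E θ = v} ∩ Icc 0 1) = 0 := by
  by_contra hpos
  set T := tser φ d E with hT
  set S : Set ℝ := {θ | T θ = v} ∩ Icc 0 1 with hS
  have hφc : Continuous φ := continuous_iff_continuousAt.2 fun x => (hφa x).continuousAt
  have hTc : Continuous T := tser_continuous hφc hφb hE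
  have hE' : Summable fun i => 1 / |E (m + i)| := by
    simpa only [add_comm] using (summable_nat_add_iff m).2 hE
  set U := tser φ d (fun i => E (m + i)) with hU
  have hUc : Continuous U := tser_continuous hφc hφb hE'
  have hd1 : (1 : ℝ) < d := by exact_mod_cast hd
  have hd0 : (0 : ℝ) < d := by linarith
  have hΛne : Λ ≠ 0 := abs_pos.1 hΛ0
  obtain ⟨L, hL0, hL⟩ := exists_lipschitz_of_periodic hφa hφp
  obtain ⟨K, hK0, hK⟩ := partial_lipschitz_bound hΛ0 hΛq hper
  have hsplit : ∀ (s : ℕ) (θ : ℝ), T θ = ∑ i ∈ Finset.range (m + s * p),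
      φ ((d : ℝ) ^ i * θ) / E i + U ((d : ℝ) ^ (m + s * p) * θ) / Λ ^ s := by
    intro s θ
    rw [hT, tser_split hφb hE (m + s * p) θ]
    simp only [mul_pow_of_periodic hper]
    rw [tser_const_mul]
  have hSlip : ∀ (s : ℕ) (x y : ℝ), |∑ i ∈ Finset.range (m + s * p), φ ((d : ℝ) ^ i * x) / E i -
      ∑ i ∈ Finset.range (m + s * p), φ ((d : ℝ) ^ i * y) / E i| ≤
        L * (K * ((d : ℝ) ^ p / |Λ|) ^ s) * |x - y| := by
    intro s x y
    rw [← Finset.sum_sub_distrib]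
    calc _ ≤ ∑ i ∈ Finset.range (m + s * p), |φ ((d : ℝ) ^ i * x) / E i -
            φ ((d : ℝ) ^ i * y) / E i| := Finset.abs_sum_le_sum_abs _ _
      _ ≤ ∑ i ∈ Finset.range (m + s * p), (d : ℝ) ^ i / |E i| * (L * |x - y|) := by
          refine Finset.sum_le_sum fun i _ => ?_
          rw [← sub_div, abs_div]
          have := hL ((d : ℝ) ^ i * x) ((d : ℝ) ^ i * y)
          rw [← mul_sub, abs_mul, abs_of_pos (by positivity : 0 < (d : ℝ) ^ i)] at this
          calc _ ≤ L * ((d : ℝ) ^ i * |x - y|) / |E i| := by gcongr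
            _ = _ := by ring
      _ ≤ K * ((d : ℝ) ^ p / |Λ|) ^ s * (L * |x - y|) := by
          rw [← Finset.sum_mul]
          gcongr
          exact hK s
      _ = _ := by ring
  have hUrec : ∀ t, U t = (∑ i ∈ Finset.range p, φ ((d : ℝ) ^ i * t) / E (m + i)) +
      U ((d : ℝ) ^ p * t) / Λ := by
    intro t
    rw [hU, tser_split hφb hE' p t]
    congr 1
    have : (fun i => E (m + (p + i))) = fun i => Λ * E (m + i) := by
      funext i
      rw [show m + (p + i) = m + i + p by ring, hper _ (by omega)]
    rw [this, tser_const_mul]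
  obtain ⟨x, hx⟩ : ∃ x, ∀ ε : ℝ, 0 < ε →
    ∀ (δ : ℕ → ℝ) (h : ℕ → ℝ), Tendsto δ atTop (nhds 0) → (∀ n, 0 < δ n) → (∀ n, |h n| ≤ 1) →
      ∀ᶠ n in atTop, ∃ h', |h' - h n| ≤ ε ∧ x + δ n * h' ∈ S := by
    have : (ae (volume.restrict S)).NeBot := ae_neBot.2 (by simpa using hpos)
    exact (ae_exists_mem_near S).exists
  have hlip : ∀ t, |t| ≤ 1 / 2 → |U t - U 0| ≤ L * K * |t| := by
    intro t ht
    refine le_of_forall_pos_le_add fun η' hη' => ?_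
    set η : ℝ := η' / (2 + 2 * (L * K)) with hη
    have hLK : 0 ≤ L * K := by positivity
    have hη0 : 0 < η := by positivity
    obtain ⟨ε₁, hε₁, hU₁⟩ := Metric.continuous_iff.1 hUc t η hη0
    obtain ⟨ε₂, hε₂, hU₂⟩ := Metric.continuous_iff.1 hUc 0 η hη0
    set ε : ℝ := min (min (ε₁ / 2) (ε₂ / 2)) η
    have hε : 0 < ε := by positivity
    have hεη : ε ≤ η := min_le_right _ _
    have hεε₁ : ε < ε₁ := ((min_le_left _ _).trans (min_le_left _ _)).trans_lt (by linarith)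
    have hεε₂ : ε < ε₂ := ((min_le_left _ _).trans (min_le_right _ _)).trans_lt (by linarith)
    set δ : ℕ → ℝ := fun s => 1 / (d : ℝ) ^ (m + s * p) with hδ
    set h0 : ℕ → ℝ := fun s => round ((d : ℝ) ^ (m + s * p) * x) - (d : ℝ) ^ (m + s * p) * x
    have hh0 : ∀ s, |h0 s| ≤ 1 / 2 := fun s => by
      simp only [h0]; rw [abs_sub_comm]; exact abs_sub_round _
    have hδ0 : ∀ s, 0 < δ s := fun s => by positivity
    have hδl : Tendsto δ atTop (nhds 0) := by
      have h1 : Tendsto (fun k : ℕ => (1 / (d : ℝ)) ^ k) atTop (nhds 0) :=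
        tendsto_pow_atTop_nhds_zero_of_lt_one (by positivity) (by rwa [div_lt_one hd0])
      have h2 : Tendsto (fun s : ℕ => m + s * p) atTop atTop :=
        tendsto_atTop_mono (fun s => by
          have := Nat.le_mul_of_pos_right s hp
          simp only [id]
          omega) tendsto_id
      have := h1.comp h2
      simpa [Function.comp_def, hδ] using this
    have ev1 := hx ε hε δ (fun s => h0 s + t) hδl hδ0
      (fun s => (abs_add_le _ _).trans (by linarith [hh0 s]))
    have ev2 := hx ε hε δ h0 hδl hδ0 (fun s => by linarith [hh0 s])
    obtain ⟨s, ⟨h1, hh1, hm1⟩, h2, hh2, hm2⟩ := (ev1.and ev2).exists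
    have hpos' : 0 < (d : ℝ) ^ (m + s * p) := by positivity
    have hmul : ∀ h, (d : ℝ) ^ (m + s * p) * (x + δ s * h) =
        (h - h0 s) + (round ((d : ℝ) ^ (m + s * p) * x) : ℤ) := by
      intro h
      simp only [hδ, h0]
      field_simp
      ring
    have e1 := hsplit s (x + δ s * h1)
    have e2 := hsplit s (x + δ s * h2)
    rw [hmul, hU, tser_add_int hφp, ← hU] at e1 e2
    rw [show T (x + δ s * h1) = v from hm1.1] at e1
    rw [show T (x + δ s * h2) = v from hm2.1] at e2
    have hs := hSlip s (x + δ s * h1) (x + δ s * h2)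
    have e3 : (U (h1 - h0 s) - U (h2 - h0 s)) = -(Λ ^ s *
        (∑ i ∈ Finset.range (m + s * p), φ ((d : ℝ) ^ i * (x + δ s * h1)) / E i -
          ∑ i ∈ Finset.range (m + s * p), φ ((d : ℝ) ^ i * (x + δ s * h2)) / E i)) := by
      have hΛs : Λ ^ s ≠ 0 := pow_ne_zero _ hΛne
      have : (U (h1 - h0 s) - U (h2 - h0 s)) / Λ ^ s = -
        (∑ i ∈ Finset.range (m + s * p), φ ((d : ℝ) ^ i * (x + δ s * h1)) / E i -
          ∑ i ∈ Finset.range (m + s * p), φ ((d : ℝ) ^ i * (x + δ s * h2)) / E i) := by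
        rw [sub_div]; linarith
      rw [← mul_neg, ← this]
      field_simp
    have h12 : |h1 - h2| ≤ |t| + 2 * ε := by
      rw [show h1 - h2 = (h1 - (h0 s + t)) - (h2 - h0 s) + t by ring]
      refine (abs_add_le _ _).trans ?_
      linarith [abs_sub (h1 - (h0 s + t)) (h2 - h0 s)]
    have hmain : |U (h1 - h0 s) - U (h2 - h0 s)| ≤ L * K * (|t| + 2 * ε) := by
      rw [e3, abs_neg, abs_mul, abs_pow]
      calc _ ≤ |Λ| ^ s * (L * (K * ((d : ℝ) ^ p / |Λ|) ^ s) *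
              |x + δ s * h1 - (x + δ s * h2)|) := by gcongr
        _ = L * K * (((d : ℝ) ^ (s * p) * δ s) * |h1 - h2|) := by
            rw [show x + δ s * h1 - (x + δ s * h2) = δ s * (h1 - h2) by ring, abs_mul,
              abs_of_pos (hδ0 s), div_pow, ← pow_mul, mul_comm p s]
            field_simp
        _ ≤ L * K * (1 * (|t| + 2 * ε)) := by
            gcongr
            simp only [hδ]
            rw [mul_one_div, div_le_one hpos']
            exact pow_le_pow_right₀ hd1.le (by omega)
        _ = _ := by ring
    have a1 := hU₁ (h1 - h0 s) (by
      rw [Real.dist_eq, sub_sub]; exact hh1.trans_lt hεε₁)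
    have a2 := hU₂ (h2 - h0 s) (by rw [Real.dist_eq, sub_zero]; exact hh2.trans_lt hεε₂)
    rw [Real.dist_eq] at a1 a2
    have a3 : |U t - U 0| ≤ |U (h1 - h0 s) - U (h2 - h0 s)| + 2 * η := by
      rw [abs_le] at *
      rw [abs_lt] at a1 a2
      have := neg_abs_le (U (h1 - h0 s) - U (h2 - h0 s))
      have := le_abs_self (U (h1 - h0 s) - U (h2 - h0 s))
      constructor <;> linarith
    calc |U t - U 0| ≤ L * K * (|t| + 2 * ε) + 2 * η := by linarith
      _ ≤ L * K * (|t| + 2 * η) + 2 * η := by gcongr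
      _ = L * K * |t| + η * (2 + 2 * (L * K)) := by ring
      _ = L * K * |t| + η' := by rw [hη, div_mul_cancel₀ _ (by positivity)]
  have hcomp : ∀ (c t : ℝ), AnalyticAt ℝ (fun t => φ (c * t)) t := fun c t =>
    AnalyticAt.fun_comp (g := φ) (f := fun t => c * t) (hφa _) (by fun_prop)
  have hUan : ∀ t, AnalyticAt ℝ U t := fun t => by
    refine analyticAt_of_rescaling
      (Φ := fun t => ∑ i ∈ Finset.range p, φ ((d : ℝ) ^ i * t) / E (m + i)) (fun t => ?_)
      (one_lt_pow₀ hd1 (by omega)) hΛne hΛq hUrec hlip t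
    exact Finset.analyticAt_fun_sum _ fun i _ => (hcomp _ t).div analyticAt_const (hE0 _)
  have hTan : AnalyticOnNhd ℝ T univ := fun t _ => by
    have e : T = fun θ => ∑ i ∈ Finset.range m, φ ((d : ℝ) ^ i * θ) / E i +
        U ((d : ℝ) ^ m * θ) := funext fun θ => by simpa using hsplit 0 θ
    rw [e]
    exact (Finset.analyticAt_fun_sum _ fun i _ => (hcomp _ t).div analyticAt_const (hE0 _)).add
      (AnalyticAt.fun_comp (g := U) (f := fun t => (d : ℝ) ^ m * t) (hUan _) (by fun_prop))
  have hinf : S.Infinite := fun hf => hpos (hf.measure_zero _)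
  obtain ⟨z, -, hz⟩ := hinf.exists_accPt_of_subset_isCompact isCompact_Icc inter_subset_right
  have hfreq : ∃ᶠ y in nhdsWithin z {z}ᶜ, T y = v :=
    (accPt_iff_frequently_nhdsNE.1 hz).mono fun y hy => hy.1
  have hconst := hTan.eqOn_of_preconnected_of_frequently_eq (analyticOnNhd_const (v := v))
    isPreconnected_univ (mem_univ z) hfreq
  obtain ⟨s, t, hst⟩ := hφnc
  exact hst (const_of_tser_const hd hφc hφp hφb hE (hE0 0) (fun θ => hconst (mem_univ θ)) s t)

/-- Uniform anti-concentration for a continuous function on `[0,1)` with null level sets. -/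
lemma exists_uniform_anticoncentration {T : ℝ → ℝ} (hT : Continuous T)
    (hnull : ∀ v, volume ({θ | T θ = v} ∩ Icc (0 : ℝ) 1) = 0) {ε : ℝ≥0∞} (hε : 0 < ε) :
    ∃ τ : ℝ, 0 < τ ∧ ∀ v, volume {θ | θ ∈ Ico (0 : ℝ) 1 ∧ |T θ - v| ≤ τ} ≤ ε := by
  by_contra! hcon
  choose v hv using fun n : ℕ => hcon (1 / ((n : ℝ) + 1)) (by positivity)
  obtain ⟨C, hC⟩ := isCompact_Icc.exists_bound_of_continuousOn (s := Icc (0 : ℝ) 1) hT.continuousOn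
  have hvb : ∀ n, v n ∈ Icc (-(C + 1)) (C + 1) := by
    intro n
    have hne : {θ | θ ∈ Ico (0 : ℝ) 1 ∧ |T θ - v n| ≤ 1 / ((n : ℝ) + 1)}.Nonempty := by
      by_contra h
      have := hv n
      rw [not_nonempty_iff_eq_empty.1 h] at this
      simp at this
    obtain ⟨θ, hθ, h1⟩ := hne
    have h2 := hC θ ⟨hθ.1, hθ.2.le⟩
    rw [Real.norm_eq_abs] at h2
    have h3 : 1 / ((n : ℝ) + 1) ≤ 1 := by
      rw [div_le_one (by positivity)]; linarith [(Nat.cast_nonneg n : (0 : ℝ) ≤ n)]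
    rw [abs_le] at h1 h2
    constructor <;> linarith
  obtain ⟨w, -, g, hg, hlim⟩ := isCompact_Icc.tendsto_subseq hvb
  set A : ℕ → Set ℝ := fun k => {θ | θ ∈ Icc (0 : ℝ) 1 ∧ |T θ - w| ≤ 1 / ((k : ℝ) + 1)} with hA
  have hAmeas : ∀ k, MeasurableSet (A k) := fun k =>
    measurableSet_Icc.inter (measurableSet_le (hT.sub continuous_const).abs.measurable measurable_const)
  have hanti : Antitone A := by
    intro i j hij θ hθ
    exact ⟨hθ.1, hθ.2.trans (one_div_le_one_div_of_le (by positivity) (by gcongr))⟩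
  have hlimA : Tendsto (volume ∘ A) atTop (nhds (volume (⋂ k, A k))) :=
    tendsto_measure_iInter_atTop (fun k => (hAmeas k).nullMeasurableSet) hanti
      ⟨0, ((measure_mono (fun θ h => h.1 : A 0 ⊆ Icc 0 1)).trans_lt (by simp)).ne⟩
  have hzero : volume (⋂ k, A k) = 0 := by
    refine measure_mono_null (fun θ hθ => ?_) (hnull w)
    have h1 := mem_iInter.1 hθ
    refine ⟨?_, (h1 0).1⟩
    have h2 : |T θ - w| ≤ 0 := ge_of_tendsto' tendsto_one_div_add_atTop_nhds_zero_nat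
      fun k => (h1 k).2
    exact sub_eq_zero.1 (abs_eq_zero.1 (le_antisymm h2 (abs_nonneg _)))
  rw [hzero] at hlimA
  obtain ⟨k, hk⟩ := (hlimA.eventually (gt_mem_nhds hε)).exists
  have hk2 : (0 : ℝ) < 1 / ((k : ℝ) + 1) / 2 := by positivity
  have ev1 := Metric.tendsto_atTop.1 hlim _ hk2
  have ev2 := (tendsto_one_div_add_atTop_nhds_zero_nat (𝕜 := ℝ)).comp hg.tendsto_atTop
  obtain ⟨n₁, hn₁⟩ := ev1
  obtain ⟨n₂, hn₂⟩ := (ev2.eventually (gt_mem_nhds hk2)).exists_forall_of_atTop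
  set n := max n₁ n₂
  have b1 := hn₁ n (le_max_left _ _)
  have b2 := hn₂ n (le_max_right _ _)
  rw [Real.dist_eq] at b1
  refine absurd (hv (g n)) (not_lt.2 (le_trans (measure_mono ?_) hk.le))
  intro θ hθ
  refine ⟨⟨hθ.1.1, hθ.1.2.le⟩, ?_⟩
  have h1 := hθ.2
  have h2 := abs_sub_le (T θ) (v (g n)) w
  simp only [Function.comp] at b1 b2
  linarith

end levelsets

/-! ### Fibre maps -/

section fibre

variable {a : ℝ} {d : ℕ} {φ : ℝ → ℝ} {α : ℝ}

lemma Viana_iterate_fst (n : ℕ) (θ x : ℝ) :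
    ((Viana a d φ α)^[n] (θ, x)).1 = (d : ℝ) ^ n * θ := by
  induction n with
  | zero => simp
  | succ n ih => rw [Function.iterate_succ_apply', Viana, ih, pow_succ]; ring

@[simp] lemma fn_zero (θ x : ℝ) : fn a d φ α 0 θ x = x := rfl

lemma fn_succ (n : ℕ) (θ x : ℝ) :
    fn a d φ α (n + 1) θ x = qm a (fn a d φ α n θ x) + α * φ ((d : ℝ) ^ n * θ) := by
  simp only [fn]
  rw [Function.iterate_succ_apply', Viana, Viana_iterate_fst]

lemma fn_add (n k : ℕ) (θ x : ℝ) :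
    fn a d φ α (n + k) θ x = fn a d φ α k ((d : ℝ) ^ n * θ) (fn a d φ α n θ x) := by
  induction k with
  | zero => simp
  | succ k ih =>
    rw [← add_assoc, fn_succ, fn_succ, ih,
      show (d : ℝ) ^ (n + k) * θ = (d : ℝ) ^ k * ((d : ℝ) ^ n * θ) by ring]

lemma fn_add_int (hφp : Function.Periodic φ 1) (n : ℕ) (θ x : ℝ) (k : ℤ) :
    fn a d φ α n (θ + k) x = fn a d φ α n θ x := by
  induction n with
  | zero => simp
  | succ n ih =>
    rw [fn_succ, fn_succ, ih]
    have := (hφp.int_mul ((d : ℤ) ^ n * k)) ((d : ℝ) ^ n * θ)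
    rw [← this]
    congr 3
    push_cast
    ring

lemma continuous_fn (hφc : Continuous φ) (n : ℕ) :
    Continuous fun p : ℝ × ℝ × ℝ => fn a d φ p.1 n p.2.1 p.2.2 := by
  induction n with
  | zero => simp only [fn_zero]; fun_prop
  | succ n ih => simp only [fn_succ, qm]; fun_prop

lemma hasDerivAt_fn (n : ℕ) (θ x : ℝ) :
    HasDerivAt (fun y => fn a d φ α n θ y)
      (∏ i ∈ Finset.range n, (-2 * fn a d φ α i θ x)) x := by
  induction n with
  | zero => simpa using hasDerivAt_id' x
  | succ n ih =>
    simp only [fn_succ, qm]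
    refine (((ih.fun_pow 2).const_sub a).add_const (α * φ ((d : ℝ) ^ n * θ))).congr_deriv ?_
    rw [Finset.prod_range_succ]
    push_cast
    ring

lemma fn_zero_alpha (n : ℕ) (θ x : ℝ) : fn a d φ 0 n θ x = (qm a)^[n] x := by
  induction n with
  | zero => simp
  | succ n ih => rw [fn_succ, ih, Function.iterate_succ_apply']; simp

end fibre

/-! ### Growth along the critical orbit -/

/-- The derivative of `(qm a)^[n]` at the critical value. -/
def Eseq (a : ℝ) (n : ℕ) : ℝ := ∏ i ∈ Finset.range n, (-2 * (qm a)^[i + 1] 0)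

lemma Eseq_succ (a : ℝ) (n : ℕ) : Eseq a (n + 1) = Eseq a n * (-2 * (qm a)^[n + 1] 0) :=
  Finset.prod_range_succ _ _

@[simp] lemma Eseq_zero (a : ℝ) : Eseq a 0 = 1 := rfl

lemma Eseq_ne_zero {a : ℝ} (h0 : ∀ i : ℕ, 1 ≤ i → (qm a)^[i] 0 ≠ 0) (n : ℕ) : Eseq a n ≠ 0 :=
  Finset.prod_ne_zero_iff.2 fun i _ => mul_ne_zero (by norm_num) (h0 _ (by omega))

lemma Eseq_add_period {a : ℝ} {m p : ℕ} (hper : (qm a)^[m + p] 0 = (qm a)^[m] 0) {i : ℕ}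
    (hi : m ≤ i) :
    Eseq a (i + p) = (∏ j ∈ Finset.range p, (-2 * (qm a)^[m + j] 0)) * Eseq a i := by
  obtain ⟨k, rfl⟩ := Nat.exists_eq_add_of_le hi
  have := prod_range_add_of_periodic (fun j => -2 * (qm a)^[m + j] 0) p (fun j => by
    rw [← add_assoc, orbit_add_period hper (by omega)]) (k + 1)
  rw [← this, mul_comm, Eseq, Finset.prod_range_add]
  congr 1
  refine Finset.prod_congr rfl fun j _ => ?_
  rw [show m + k + j + 1 = m + (k + 1 + j) by ring]

/-- Exponential growth of a sequence which is eventually multiplicatively periodic. -/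
lemma exists_growth {E : ℕ → ℝ} {m p : ℕ} {Λ : ℝ} (hE0 : ∀ i, E i ≠ 0) (hp : 1 ≤ p)
    (hΛ : 1 < |Λ|) (hper : ∀ i, m ≤ i → E (i + p) = Λ * E i) :
    ∃ c σ : ℝ, 0 < c ∧ 1 < σ ∧ ∀ n l, c * σ ^ l * |E n| ≤ |E (n + l)| := by
  set σ : ℝ := |Λ| ^ (1 / (p : ℝ)) with hσ
  have hp0 : (p : ℝ) ≠ 0 := by positivity
  have hσ1 : 1 < σ := Real.one_lt_rpow hΛ (by positivity)
  have hσ0 : 0 < σ := by linarith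
  have hσp : σ ^ p = |Λ| := by
    rw [hσ, ← Real.rpow_natCast, ← Real.rpow_mul (abs_nonneg _), one_div_mul_cancel hp0,
      Real.rpow_one]
  set H : ℕ → ℝ := fun n => |E n| / σ ^ n with hH
  have hH0 : ∀ n, 0 < H n := fun n => div_pos (abs_pos.2 (hE0 n)) (by positivity)
  have hHp : ∀ n, m ≤ n → H (n + p) = H n := by
    intro n hn
    simp only [hH]
    rw [hper n hn, abs_mul, pow_add, hσp, mul_comm, mul_div_mul_right _ _ (by positivity)]
  have hred : ∀ n, ∃ n' ∈ Finset.range (m + p), H n = H n' := by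
    intro n
    induction n using Nat.strong_induction_on with
    | _ n ih =>
      by_cases hn : n < m + p
      · exact ⟨n, Finset.mem_range.2 hn, rfl⟩
      · obtain ⟨n', hn', e⟩ := ih (n - p) (by omega)
        refine ⟨n', hn', ?_⟩
        rw [← e, ← hHp (n - p) (by omega), Nat.sub_add_cancel (by omega)]
  have hne : (Finset.range (m + p)).Nonempty := ⟨0, Finset.mem_range.2 (by omega)⟩
  obtain ⟨n₁, -, hmin⟩ := Finset.exists_min_image _ H hne
  obtain ⟨n₂, -, hmax⟩ := Finset.exists_max_image _ H hne
  refine ⟨H n₁ / H n₂, σ, div_pos (hH0 _) (hH0 _), hσ1, fun n l => ?_⟩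
  have hlow : H n₁ ≤ H (n + l) := by
    obtain ⟨n', hn', e⟩ := hred (n + l); rw [e]; exact hmin _ hn'
  have hup : H n ≤ H n₂ := by
    obtain ⟨n', hn', e⟩ := hred n; rw [e]; exact hmax _ hn'
  have e1 : |E n| = H n * σ ^ n := by simp only [hH]; field_simp
  have e2 : |E (n + l)| = H (n + l) * σ ^ (n + l) := by simp only [hH]; field_simp
  rw [e1, e2, pow_add]
  have h2 := hH0 n₂
  have h1 := hH0 n₁
  calc H n₁ / H n₂ * σ ^ l * (H n * σ ^ n) ≤ H n₁ / H n₂ * σ ^ l * (H n₂ * σ ^ n) := by gcongr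
    _ = H n₁ * (σ ^ n * σ ^ l) := by field_simp
    _ ≤ _ := by gcongr

section growth

variable {E : ℕ → ℝ} {c σ : ℝ}

lemma tail_inv_bound (hE0 : ∀ i, E i ≠ 0) (hc : 0 < c) (hσ : 1 < σ)
    (hg : ∀ n l, c * σ ^ l * |E n| ≤ |E (n + l)|) (n : ℕ) :
    Summable (fun i => 1 / |E (n + i)|) ∧
      ∑' i, 1 / |E (n + i)| ≤ 1 / (c * (1 - σ⁻¹)) / |E n| := by
  have hσ0 : 0 < σ := by linarith
  have hEn : 0 < |E n| := abs_pos.2 (hE0 n)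
  have hb : ∀ i, 1 / |E (n + i)| ≤ 1 / (c * |E n|) * σ⁻¹ ^ i := by
    intro i
    rw [inv_pow, ← one_div, one_div_mul_one_div]
    exact one_div_le_one_div_of_le (by positivity) (by linarith [hg n i])
  have hgeo := hasSum_geometric_of_lt_one (inv_nonneg.2 hσ0.le) (inv_lt_one_of_one_lt₀ hσ)
  have hgeo2 := hgeo.mul_left (1 / (c * |E n|))
  have hs : Summable (fun i => 1 / |E (n + i)|) :=
    Summable.of_nonneg_of_le (fun i => by positivity) hb hgeo2.summable
  refine ⟨hs, (hs.tsum_le_tsum hb hgeo2.summable).trans (le_of_eq ?_)⟩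
  rw [hgeo2.tsum_eq, ← one_div, one_div_mul_one_div, div_div]
  congr 1
  ring

lemma sum_abs_le (hc : 0 < c) (hσ : 1 < σ)
    (hg : ∀ n l, c * σ ^ l * |E n| ≤ |E (n + l)|) (n : ℕ) :
    ∑ i ∈ Finset.range (n + 1), |E i| ≤ 1 / (c * (1 - σ⁻¹)) * |E n| := by
  have hσ0 : 0 < σ := by linarith
  have hgeo := hasSum_geometric_of_lt_one (inv_nonneg.2 hσ0.le) (inv_lt_one_of_one_lt₀ hσ)
  have h1σ : 0 < 1 - σ⁻¹ := by linarith [inv_lt_one_of_one_lt₀ hσ]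
  rw [← Finset.sum_range_reflect]
  calc _ ≤ ∑ j ∈ Finset.range (n + 1), |E n| / c * σ⁻¹ ^ j := by
        refine Finset.sum_le_sum fun j hj => ?_
        rw [Finset.mem_range] at hj
        have := hg (n + 1 - 1 - j) j
        rw [show n + 1 - 1 - j + j = n by omega] at this
        rw [inv_pow, ← div_eq_mul_inv, div_div, le_div_iff₀ (by positivity)]
        linarith
    _ = |E n| / c * ∑ j ∈ Finset.range (n + 1), σ⁻¹ ^ j := by rw [Finset.mul_sum]
    _ ≤ |E n| / c * (1 - σ⁻¹)⁻¹ := by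
        gcongr
        exact sum_le_hasSum _ (fun i _ => by positivity) hgeo
    _ = _ := by
        field_simp

end growth

section critical

variable {a β : ℝ}

lemma beta_lt_two (ha : a < 2) (hβ2 : β < |(-1 - Real.sqrt (1 + 4 * a)) / 2|) : β < 2 := by
  have h1 : Real.sqrt (1 + 4 * a) < 3 := by
    rw [Real.sqrt_lt' (by norm_num)]; linarith
  have h2 := Real.sqrt_nonneg (1 + 4 * a)
  rw [abs_of_nonpos (by linarith)] at hβ2
  linarith

lemma orbit_mem (hβ1 : 1 < β) (hβmap : ∀ x ∈ Icc (-β) β, qm a x ∈ Ioo (-β) β) (i : ℕ) :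
    (qm a)^[i] 0 ∈ Icc (-β) β := by
  induction i with
  | zero => constructor <;> simp <;> linarith
  | succ i ih => rw [Function.iterate_succ_apply']; exact Ioo_subset_Icc_self (hβmap _ ih)

/-- The derivative of the unperturbed iterates inherits the bounds of the perturbed ones. -/
lemma abs_prod_orbit_le {d : ℕ} {φ : ℝ → ℝ} (hφc : Continuous φ) {C₁ R₁ α₁ x : ℝ} (hα₁ : 0 < α₁)
    {k : ℕ} (hk : ∀ α : ℝ, 0 < α → α < α₁ → |deriv (fun y => fn a d φ α k 0 y) x| ≤ C₁ * R₁ ^ k) :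
    |∏ i ∈ Finset.range k, (-2 * (qm a)^[i] x)| ≤ C₁ * R₁ ^ k := by
  have hcont : Continuous fun α : ℝ => |∏ i ∈ Finset.range k, (-2 * fn a d φ α i 0 x)| := by
    refine continuous_abs.comp (continuous_finsetProd _ fun i _ => continuous_const.mul ?_)
    exact (continuous_fn hφc i).comp (by fun_prop : Continuous fun α : ℝ => (α, (0 : ℝ), x))
  have hlim : Tendsto (fun α : ℝ => |∏ i ∈ Finset.range k, (-2 * fn a d φ α i 0 x)|)
      (nhdsWithin 0 (Ioi 0)) (nhds |∏ i ∈ Finset.range k, (-2 * (qm a)^[i] x)|) := by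
    have := (hcont.tendsto 0).mono_left (nhdsWithin_le_nhds (s := Ioi 0))
    simpa only [fn_zero_alpha] using this
  refine le_of_tendsto hlim ?_
  filter_upwards [Ioo_mem_nhdsGT hα₁] with α hα
  rw [← (hasDerivAt_fn k 0 x).deriv]
  exact hk α hα.1 hα.2

lemma le_of_forall_pow_le_mul {A B C : ℝ} (hB : 0 < B)
    (h : ∀ k : ℕ, A ^ k ≤ C * B ^ k) : A ≤ B := by
  by_contra! hlt
  obtain ⟨k, hk⟩ := pow_unbounded_of_one_lt C ((one_lt_div hB).2 hlt)
  have := h k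
  rw [div_pow, lt_div_iff₀ (by positivity)] at hk
  linarith

lemma exists_critical_period {d : ℕ} {φ : ℝ → ℝ} (ha : a < 2) (hpre : StrictlyPreperiodic a)
    (hd : 2 ≤ d) (hφc : Continuous φ) (hβ1 : 1 < β)
    (hβ2 : β < |(-1 - Real.sqrt (1 + 4 * a)) / 2|)
    (hβmap : ∀ x ∈ Icc (-β) β, qm a x ∈ Ioo (-β) β)
    (hdom : ∃ C₁ R₁ : ℝ, R₁ ∈ Ioo (0 : ℝ) 2 ∧ ∃ α₁ > 0, ∀ α : ℝ, 0 < α → α < α₁ →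
      ∀ θ x : ℝ, x ∈ Icc (-β) β → ∀ k : ℕ,
        |deriv (fun y => fn a d φ α k θ y) x| ≤ C₁ * R₁ ^ k) :
    ∃ (m p : ℕ) (Λ : ℝ), 1 ≤ p ∧ 1 < |Λ| ∧ |Λ| < (d : ℝ) ^ p ∧
      ∀ i, m ≤ i → Eseq a (i + p) = Λ * Eseq a i := by
  obtain ⟨h0, m, p, hm, hp, hper⟩ := hpre
  set Λ : ℝ := ∏ j ∈ Finset.range p, (-2 * (qm a)^[m + j] 0) with hΛdef
  have hΛ1 : 1 < |Λ| := by
    have := critical_cycle_repelling ha.le (fun i => by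
      have := orbit_mem hβ1 hβmap i
      have := beta_lt_two ha hβ2
      exact (abs_le.2 ⟨(orbit_mem hβ1 hβmap i).1, (orbit_mem hβ1 hβmap i).2⟩).trans_lt this)
      h0 hm hp hper
    rw [hΛdef, Finset.abs_prod]
    simpa [abs_mul] using this
  refine ⟨m, p, Λ, hp, hΛ1, ?_, fun i hi => Eseq_add_period hper hi⟩
  obtain ⟨C₁, R₁, hR, α₁, hα₁, hD⟩ := hdom
  have hprod : ∀ k : ℕ, ∏ j ∈ Finset.range (k * p), (-2 * (qm a)^[m + j] 0) = Λ ^ k := by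
    intro k
    induction k with
    | zero => simp
    | succ k ih =>
      rw [Nat.succ_mul, Finset.prod_range_add, ih, pow_succ, hΛdef]
      congr 1
      exact prod_range_add_of_periodic (fun j => -2 * (qm a)^[m + j] 0) p (fun j => by
        rw [← add_assoc, orbit_add_period hper (by omega)]) (k * p)
  have hle : |Λ| ≤ R₁ ^ p := by
    refine le_of_forall_pow_le_mul (C := C₁) (pow_pos hR.1 p) fun k => ?_
    have := abs_prod_orbit_le (a := a) (d := d) hφc hα₁ (x := (qm a)^[m] 0) (k := k * p)
      fun α hα hα' => hD α hα hα' 0 _ (orbit_mem hβ1 hβmap m) (k * p)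
    rw [← abs_pow, ← hprod, ← pow_mul, mul_comm p k]
    simpa only [← Function.iterate_add_apply, add_comm] using this
  refine hle.trans_lt ?_
  refine (pow_lt_pow_left₀ hR.2 hR.1.le (by omega)).trans_le ?_
  gcongr
  exact_mod_cast hd

end critical

/-! ### Shadowing intervals -/

section intervals

variable {a α ξ₀ : ℝ}

lemma isCompact_image_IEnd (n : ℕ) :
    IsCompact (qm a '' Icc (IEnd a α n).1 (IEnd a α n).2) :=
  isCompact_Icc.image (by unfold qm; fun_prop)

lemma qm_add_mem_IEnd {n : ℕ} {u t : ℝ} (hu : u ∈ Icc (IEnd a α n).1 (IEnd a α n).2)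
    (ht : |t| ≤ α) : qm a u + t ∈ Icc (IEnd a α (n + 1)).1 (IEnd a α (n + 1)).2 := by
  have hK := isCompact_image_IEnd (a := a) (α := α) n
  have h1 := csInf_le hK.bddBelow (mem_image_of_mem _ hu)
  have h2 := le_csSup hK.bddAbove (mem_image_of_mem _ hu)
  rw [abs_le] at ht
  constructor
  · change sInf _ - α ≤ _; linarith
  · change _ ≤ sSup _ + α; linarith

lemma orbit_mem_IEnd (hα : 0 < α) (n : ℕ) :
    (qm a)^[n + 1] 0 ∈ Icc (IEnd a α n).1 (IEnd a α n).2 := by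
  induction n with
  | zero => constructor <;> simp [IEnd] <;> linarith
  | succ n ih =>
    rw [Function.iterate_succ_apply']
    simpa using qm_add_mem_IEnd ih (t := 0) (by simpa using hα.le)

lemma fn_mem_IEnd {d : ℕ} {φ : ℝ → ℝ} (hφb : ∀ θ : ℝ, |φ θ| ≤ 1) (hα : 0 < α) {θ X : ℝ}
    (hX : X ^ 2 ≤ α) (n : ℕ) :
    fn a d φ α (n + 1) θ X ∈ Icc (IEnd a α n).1 (IEnd a α n).2 := by
  have ht : ∀ θ, |α * φ θ| ≤ α := fun θ => by
    rw [abs_mul, abs_of_pos hα]; exact mul_le_of_le_one_right hα.le (hφb θ)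
  induction n with
  | zero =>
    have := abs_le.1 (ht (d ^ 0 * θ))
    rw [fn_succ, fn_zero]
    constructor <;> simp only [IEnd, qm] <;> nlinarith [sq_nonneg X]
  | succ n ih =>
    rw [fn_succ]
    exact qm_add_mem_IEnd ih (ht _)

lemma len_succ_ge (hα : 0 < α) (n : ℕ) : 2 * α ≤ len a α (n + 1) ∧
    |(IEnd a α n).1 + (IEnd a α n).2| * len a α n + 2 * α ≤ len a α (n + 1) := by
  have hK := isCompact_image_IEnd (a := a) (α := α) n
  have hx := orbit_mem_IEnd (a := a) hα n
  have hl : (IEnd a α n).1 ≤ (IEnd a α n).2 := hx.1.trans hx.2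
  have h1 := fun u (hu : u ∈ Icc (IEnd a α n).1 (IEnd a α n).2) =>
    csInf_le hK.bddBelow (mem_image_of_mem (qm a) hu)
  have h2 := fun u (hu : u ∈ Icc (IEnd a α n).1 (IEnd a α n).2) =>
    le_csSup hK.bddAbove (mem_image_of_mem (qm a) hu)
  have e : len a α (n + 1) = sSup (qm a '' Icc (IEnd a α n).1 (IEnd a α n).2) -
      sInf (qm a '' Icc (IEnd a α n).1 (IEnd a α n).2) + 2 * α := by
    simp only [len, IEnd]; ring
  have key : ∀ u ∈ Icc (IEnd a α n).1 (IEnd a α n).2, ∀ v ∈ Icc (IEnd a α n).1 (IEnd a α n).2,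
      qm a u - qm a v + 2 * α ≤ len a α (n + 1) := fun u hu v hv => by
    rw [e]; linarith [h1 v hv, h2 u hu]
  constructor
  · simpa using key _ hx _ hx
  · have k1 := key _ (left_mem_Icc.2 hl) _ (right_mem_Icc.2 hl)
    have k2 := key _ (right_mem_Icc.2 hl) _ (left_mem_Icc.2 hl)
    rcases abs_cases ((IEnd a α n).1 + (IEnd a α n).2) with ⟨h, -⟩ | ⟨h, -⟩ <;> rw [h] <;>
      simp only [qm, len] at k1 k2 ⊢ <;> nlinarith

lemma len_ge (hα : 0 < α) (n : ℕ) : 2 * α ≤ len a α n := by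
  cases n with
  | zero => simp only [len, IEnd]; linarith
  | succ n => exact (len_succ_ge hα n).1

lemma abs_sub_le_len {n : ℕ} {u v : ℝ} (hu : u ∈ Icc (IEnd a α n).1 (IEnd a α n).2)
    (hv : v ∈ Icc (IEnd a α n).1 (IEnd a α n).2) : |u - v| ≤ len a α n := by
  rw [abs_le, len]
  constructor <;> linarith [hu.1, hu.2, hv.1, hv.2]

lemma len_succ_le (hα : 0 < α) (n : ℕ) :
    len a α (n + 1) ≤ (2 * |(qm a)^[n + 1] 0| + 2 * len a α n) * len a α n + 2 * α := by
  have hx := orbit_mem_IEnd (a := a) hα n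
  have hne : (qm a '' Icc (IEnd a α n).1 (IEnd a α n).2).Nonempty := ⟨_, mem_image_of_mem _ hx⟩
  have : sSup (qm a '' Icc (IEnd a α n).1 (IEnd a α n).2) ≤
      sInf (qm a '' Icc (IEnd a α n).1 (IEnd a α n).2) +
        (2 * |(qm a)^[n + 1] 0| + 2 * len a α n) * len a α n := by
    refine csSup_le hne ?_
    rintro _ ⟨u, hu, rfl⟩
    rw [← sub_le_iff_le_add]
    refine le_csInf hne ?_
    rintro _ ⟨v, hv, rfl⟩
    have h1 : |u + v| ≤ 2 * |(qm a)^[n + 1] 0| + 2 * len a α n := by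
      rw [show u + v = 2 * (qm a)^[n + 1] 0 + ((u - (qm a)^[n + 1] 0) + (v - (qm a)^[n + 1] 0))
        by ring]
      refine (abs_add_le _ _).trans ?_
      rw [abs_mul, abs_two]
      linarith [abs_add_le (u - (qm a)^[n + 1] 0) (v - (qm a)^[n + 1] 0),
        abs_sub_le_len hu hx, abs_sub_le_len hv hx]
    have h2 : |(u + v) * (v - u)| ≤
        (2 * |(qm a)^[n + 1] 0| + 2 * len a α n) * len a α n := by
      rw [abs_mul]
      have := abs_sub_le_len hv hu
      gcongr
      exact (abs_nonneg _).trans h1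
    have h3 := le_abs_self ((u + v) * (v - u))
    simp only [qm]
    linarith
  have e : len a α (n + 1) = sSup (qm a '' Icc (IEnd a α n).1 (IEnd a α n).2) -
      sInf (qm a '' Icc (IEnd a α n).1 (IEnd a α n).2) + 2 * α := by
    simp only [len, IEnd]; ring
  linarith

/-- The defining properties of `N(α)`. -/
lemma Nal_spec (hα : 0 < α) (hξ₀ : 0 < ξ₀) : (∀ n < Nal a ξ₀ α, len a α n < ξ₀) ∧
    ∑ n ∈ Finset.range (Nal a ξ₀ α), len a α n ≤ ξ₀ ∧
    (ξ₀ ≤ len a α (Nal a ξ₀ α) ∨ ξ₀ < ∑ n ∈ Finset.range (Nal a ξ₀ α + 1), len a α n) := by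
  set s := {N : ℕ | (∀ n : ℕ, 1 ≤ n → n ≤ N → len a α (n - 1) < ξ₀) ∧
    ∑ n ∈ Finset.range N, len a α n ≤ ξ₀} with hs
  have hbdd : BddAbove s := by
    refine ⟨⌈ξ₀ / (2 * α)⌉₊, fun N hN => ?_⟩
    have h1 : ∑ n ∈ Finset.range N, 2 * α ≤ ∑ n ∈ Finset.range N, len a α n :=
      Finset.sum_le_sum fun n _ => len_ge hα n
    rw [Finset.sum_const, Finset.card_range, nsmul_eq_mul] at h1
    have h2 : (N : ℝ) ≤ ξ₀ / (2 * α) := by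
      rw [le_div_iff₀ (by positivity)]; linarith [hN.2]
    exact_mod_cast h2.trans (Nat.le_ceil _)
  have hne : s.Nonempty := ⟨0, fun n h1 h2 => by omega, by simpa using hξ₀.le⟩
  have hmem : Nal a ξ₀ α ∈ s := Nat.sSup_mem hne hbdd
  have hnot : Nal a ξ₀ α + 1 ∉ s := fun h => by
    have : Nal a ξ₀ α + 1 ≤ Nal a ξ₀ α := le_csSup hbdd h
    omega
  have hlt : ∀ n < Nal a ξ₀ α, len a α n < ξ₀ := fun n hn => by
    simpa using hmem.1 (n + 1) (by omega) (by omega)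
  refine ⟨hlt, hmem.2, ?_⟩
  by_contra! hcon
  refine hnot ⟨fun n h1 h2 => ?_, hcon.2⟩
  rcases Nat.lt_or_ge (n - 1) (Nal a ξ₀ α) with h | h
  · exact hlt _ h
  · rw [show n - 1 = Nal a ξ₀ α by omega]; exact hcon.1

lemma len_lower (hα : 0 < α) (hξ₀ : 0 < ξ₀) (hx : ∀ n, 2 * ξ₀ ≤ |(qm a)^[n + 1] 0|) {n : ℕ}
    (hsum : ∑ i ∈ Finset.range n, len a α i ≤ ξ₀) : 3 * α * |Eseq a n| ≤ len a α n := by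
  have hlen0 : ∀ i, 0 ≤ len a α i := fun i => le_trans (by positivity) (len_ge hα i)
  have key : ∀ k ≤ n, 4 * α * |Eseq a k| *
      (1 - (∑ i ∈ Finset.range k, len a α i) / (4 * ξ₀)) ≤ len a α k := by
    intro k
    induction k with
    | zero => intro _; simp only [len, IEnd, Eseq_zero]; simp; linarith
    | succ k ih =>
      intro hk
      have ih := ih (by omega)
      have h1 := (len_succ_ge (a := a) hα k).2
      have hxk := orbit_mem_IEnd (a := a) hα k
      set x := (qm a)^[k + 1] 0 with hxdef
      have h2 : 2 * |x| - len a α k ≤ |(IEnd a α k).1 + (IEnd a α k).2| := by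
        have h3 : |2 * x - ((IEnd a α k).1 + (IEnd a α k).2)| ≤ len a α k := by
          rw [abs_le, len]; constructor <;> linarith [hxk.1, hxk.2]
        have h4 := abs_sub_abs_le_abs_sub (2 * x) ((IEnd a α k).1 + (IEnd a α k).2)
        rw [abs_mul, abs_two] at h4
        linarith
      have hxx : 2 * ξ₀ ≤ |x| := hx k
      have hx0 : 0 < |x| := by linarith
      set S := ∑ i ∈ Finset.range k, len a α i with hS
      have hS0 : 0 ≤ S := Finset.sum_nonneg fun i _ => hlen0 i
      have hS1 : S + len a α k ≤ ξ₀ := by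
        rw [hS, ← Finset.sum_range_succ]
        exact (Finset.sum_le_sum_of_subset_of_nonneg (Finset.range_mono hk)
          fun i _ _ => hlen0 i).trans hsum
      have hk0 := hlen0 k
      rw [Finset.sum_range_succ, Eseq_succ, abs_mul, abs_mul, abs_neg, abs_two]
      set b := len a α k / (4 * ξ₀) with hb
      set A := S / (4 * ξ₀) with hA
      have hb0 : 0 ≤ b := by positivity
      have hA0 : 0 ≤ A := by positivity
      have hb1 : b ≤ 1 := by rw [hb, div_le_one (by positivity)]; linarith
      have e : (S + len a α k) / (4 * ξ₀) = A + b := add_div _ _ _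
      rw [e]
      have hbl : len a α k ≤ 2 * |x| * b := by
        have : len a α k = 4 * ξ₀ * b := by rw [hb]; field_simp
        nlinarith
      calc 4 * α * (|Eseq a k| * (2 * |x|)) * (1 - (A + b))
          ≤ 4 * α * (|Eseq a k| * (2 * |x|)) * ((1 - A) * (1 - b)) := by
            gcongr; nlinarith
        _ = 2 * |x| * (1 - b) * (4 * α * |Eseq a k| * (1 - A)) := by ring
        _ ≤ 2 * |x| * (1 - b) * len a α k := by
            have : 0 ≤ 1 - b := by linarith
            gcongr
        _ = (2 * |x| - 2 * |x| * b) * len a α k := by ring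
        _ ≤ (2 * |x| - len a α k) * len a α k := by gcongr
        _ ≤ |(IEnd a α k).1 + (IEnd a α k).2| * len a α k := by gcongr
        _ ≤ len a α (k + 1) := by linarith
  refine le_trans ?_ (key n le_rfl)
  have h1 : (∑ i ∈ Finset.range n, len a α i) / (4 * ξ₀) ≤ 1 / 4 := by
    rw [div_le_iff₀ (by positivity)]; linarith
  have h2 : 0 ≤ 4 * α * |Eseq a n| := by positivity
  nlinarith

lemma len_upper (hα : 0 < α) (hξ₀ : 0 < ξ₀) (hx : ∀ n, 2 * ξ₀ ≤ |(qm a)^[n + 1] 0|) {n : ℕ}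
    (hsum : ∑ i ∈ Finset.range n, len a α i ≤ ξ₀) :
    len a α n ≤ 8 * α * (∑ i ∈ Finset.range (n + 1), 1 / |Eseq a i|) * |Eseq a n| := by
  have hlen0 : ∀ i, 0 ≤ len a α i := fun i => le_trans (by positivity) (len_ge hα i)
  have key : ∀ k ≤ n, len a α k ≤ Real.exp ((∑ i ∈ Finset.range k, len a α i) / (2 * ξ₀)) *
      (4 * α * (∑ i ∈ Finset.range (k + 1), 1 / |Eseq a i|)) * |Eseq a k| := by
    intro k
    induction k with
    | zero => intro _; simp only [len, IEnd, Eseq_zero]; simp; linarith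
    | succ k ih =>
      intro hk
      have ih := ih (by omega)
      have h1 := len_succ_le (a := a) hα k
      set x := (qm a)^[k + 1] 0 with hxdef
      have hxx : 2 * ξ₀ ≤ |x| := hx k
      have hx0 : 0 < |x| := by linarith
      have hEk : |Eseq a (k + 1)| = 2 * |x| * |Eseq a k| := by
        rw [Eseq_succ, abs_mul, abs_mul, abs_neg, abs_two]; ring
      have hE0 : 0 < |Eseq a k| := abs_pos.2 (Eseq_ne_zero (fun i hi h => by
        have := hx (i - 1)
        rw [Nat.sub_add_cancel hi, h, abs_zero] at this
        linarith) k)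
      have hE1 : 0 < |Eseq a (k + 1)| := by rw [hEk]; positivity
      rw [Finset.sum_range_succ _ k, add_div, Real.exp_add, Finset.sum_range_succ _ (k + 1)]
      set S := (∑ i ∈ Finset.range k, len a α i) / (2 * ξ₀) with hS
      set B := ∑ i ∈ Finset.range (k + 1), 1 / |Eseq a i| with hB
      set b := len a α k / (2 * ξ₀) with hb
      have hB0 : 0 ≤ B := Finset.sum_nonneg fun i _ => by positivity
      have hS0 : 0 ≤ S := div_nonneg (Finset.sum_nonneg fun i _ => hlen0 i) (by positivity)
      have hb0 : 0 ≤ b := div_nonneg (hlen0 k) (by positivity)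
      have hbl : 2 * len a α k ≤ 2 * |x| * b := by
        have : len a α k = 2 * ξ₀ * b := by rw [hb]; field_simp
        nlinarith
      have hexp : 1 + b ≤ Real.exp b := by linarith [Real.add_one_le_exp b]
      have hge1 : 1 ≤ Real.exp S * Real.exp b := by
        rw [← Real.exp_add]; exact Real.one_le_exp (by positivity)
      have hk0 := hlen0 k
      calc len a α (k + 1) ≤ (2 * |x| + 2 * |x| * b) * len a α k + 2 * α := by
            refine h1.trans ?_
            gcongr
        _ = 2 * |x| * (1 + b) * len a α k + 2 * α := by ring
        _ ≤ 2 * |x| * Real.exp b * (Real.exp S * (4 * α * B) * |Eseq a k|) +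
            Real.exp S * Real.exp b * (4 * α) := by
            have : 2 * α ≤ Real.exp S * Real.exp b * (4 * α) := by nlinarith
            gcongr
        _ = Real.exp S * Real.exp b * (4 * α * (B + 1 / |Eseq a (k + 1)|)) *
            |Eseq a (k + 1)| := by
            have h2 : 1 / |Eseq a (k + 1)| * |Eseq a (k + 1)| = 1 := one_div_mul_cancel hE1.ne'
            linear_combination (-(Real.exp S * Real.exp b * (4 * α))) * h2 -
              Real.exp S * Real.exp b * (4 * α * B) * hEk
  refine (key n le_rfl).trans ?_
  have h1 : Real.exp ((∑ i ∈ Finset.range n, len a α i) / (2 * ξ₀)) ≤ 2 := by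
    have h2 : (∑ i ∈ Finset.range n, len a α i) / (2 * ξ₀) ≤ 1 / 2 := by
      rw [div_le_iff₀ (by positivity)]; linarith
    refine (Real.exp_le_exp.2 h2).trans ?_
    rw [← Real.le_log_iff_exp_le (by norm_num)]
    linarith [Real.log_two_gt_d9]
  have hB0 : 0 ≤ ∑ i ∈ Finset.range (n + 1), 1 / |Eseq a i| :=
    Finset.sum_nonneg fun i _ => by positivity
  calc _ ≤ 2 * (4 * α * (∑ i ∈ Finset.range (n + 1), 1 / |Eseq a i|)) * |Eseq a n| := by gcongr
    _ = _ := by ring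

/-- Comparison of the scale `α` with the derivative along the critical orbit up to time `N(α)`. -/
lemma Nal_bounds {c σ : ℝ} (hξ₀ : 0 < ξ₀) (hx : ∀ n, 2 * ξ₀ ≤ |(qm a)^[n + 1] 0|)
    (hE0 : ∀ i, Eseq a i ≠ 0) (hc : 0 < c) (hσ : 1 < σ)
    (hg : ∀ n l, c * σ ^ l * |Eseq a n| ≤ |Eseq a (n + l)|) :
    ∃ C c₃ : ℝ, 0 < C ∧ 0 < c₃ ∧ ∀ α, 0 < α →
      (∀ n ≤ Nal a ξ₀ α, len a α n ≤ C * α * |Eseq a n|) ∧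
      (∀ n < Nal a ξ₀ α, 3 * α * |Eseq a n| ≤ ξ₀) ∧ c₃ ≤ α * |Eseq a (Nal a ξ₀ α)| := by
  set C' : ℝ := 1 / (c * (1 - σ⁻¹)) with hC'
  have h1σ : 0 < 1 - σ⁻¹ := by linarith [inv_lt_one_of_one_lt₀ hσ]
  have hC'0 : 0 < C' := by positivity
  refine ⟨8 * C', ξ₀ / (8 * C' * (1 + C')), by positivity, by positivity, fun α hα => ?_⟩
  obtain ⟨hlt, hsum, hmax⟩ := Nal_spec (a := a) hα hξ₀
  have hlen0 : ∀ i, 0 ≤ len a α i := fun i => le_trans (by positivity) (len_ge hα i)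
  have hsum' : ∀ n ≤ Nal a ξ₀ α, ∑ i ∈ Finset.range n, len a α i ≤ ξ₀ := fun n hn =>
    (Finset.sum_le_sum_of_subset_of_nonneg (Finset.range_mono hn) fun i _ _ => hlen0 i).trans hsum
  have hup : ∀ n ≤ Nal a ξ₀ α, len a α n ≤ 8 * C' * α * |Eseq a n| := by
    intro n hn
    refine (len_upper hα hξ₀ hx (hsum' n hn)).trans ?_
    obtain ⟨hs, hb⟩ := tail_inv_bound hE0 hc hσ hg 0
    simp only [zero_add, Eseq_zero, abs_one, div_one] at hs hb
    have := (hs.sum_le_tsum (Finset.range (n + 1)) fun i _ => by positivity).trans hb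
    calc _ ≤ 8 * α * C' * |Eseq a n| := by gcongr
      _ = _ := by ring
  refine ⟨hup, fun n hn => (len_lower hα hξ₀ hx (hsum' n hn.le)).trans (hlt n hn).le, ?_⟩
  set N := Nal a ξ₀ α
  rw [div_le_iff₀ (by positivity)]
  have hEN : 0 ≤ α * |Eseq a N| := by positivity
  rcases hmax with h | h
  · have := hup N le_rfl
    have h2 : 0 ≤ 8 * C' * C' * (α * |Eseq a N|) := by positivity
    nlinarith
  · have h1 : ∑ n ∈ Finset.range (N + 1), len a α n ≤
        8 * C' * α * ∑ n ∈ Finset.range (N + 1), |Eseq a n| := by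
      rw [Finset.mul_sum]
      exact Finset.sum_le_sum fun n hn => hup n (by rw [Finset.mem_range] at hn; omega)
    have h2 := sum_abs_le hc hσ hg N
    have h3 : 8 * C' * α * ∑ n ∈ Finset.range (N + 1), |Eseq a n| ≤
        8 * C' * α * (C' * |Eseq a N|) := by gcongr
    have h4 : 0 ≤ 8 * C' * (α * |Eseq a N|) := by positivity
    nlinarith

lemma lt_abs_fn_of_le_Nal {d : ℕ} {φ : ℝ → ℝ} (hφb : ∀ θ : ℝ, |φ θ| ≤ 1) (hα : 0 < α)
    (hξ₀ : 0 < ξ₀) (hx : ∀ n, 2 * ξ₀ ≤ |(qm a)^[n + 1] 0|) {θ X : ℝ} (hX : X ^ 2 ≤ α) {n : ℕ}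
    (hn1 : 1 ≤ n) (hn : n ≤ Nal a ξ₀ α) : ξ₀ < |fn a d φ α n θ X| := by
  obtain ⟨k, rfl⟩ := Nat.exists_eq_add_of_le' hn1
  have h1 := abs_sub_le_len (fn_mem_IEnd (a := a) (d := d) (θ := θ) hφb hα hX k)
    (orbit_mem_IEnd hα k)
  have h2 := (Nal_spec (a := a) hα hξ₀).1 k (by omega)
  have h3 := hx k
  have h4 := abs_sub_abs_le_abs_sub ((qm a)^[k + 1] 0) (fn a d φ α (k + 1) θ X)
  rw [abs_sub_comm] at h4
  linarith

end intervals

/-! ### Measure of early returns -/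

section early

variable {a α ξ₀ : ℝ} {d : ℕ} {φ : ℝ → ℝ}

/-- The deviation from the critical orbit, written in terms of the partial sums of the series. -/
lemma fn_sub_orbit (hE0 : ∀ i, Eseq a i ≠ 0) (θ X : ℝ) (n : ℕ) :
    fn a d φ α (n + 1) θ X - (qm a)^[n + 1] 0 = Eseq a n *
      (α * (∑ i ∈ Finset.range (n + 1), φ ((d : ℝ) ^ i * θ) / Eseq a i) - X ^ 2 -
        ∑ i ∈ Finset.range n,
          (fn a d φ α (i + 1) θ X - (qm a)^[i + 1] 0) ^ 2 / Eseq a (i + 1)) := by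
  induction n with
  | zero =>
    simp [fn_succ, qm]
    ring
  | succ n ih =>
    have h1 := hE0 (n + 1)
    rw [fn_succ (n + 1), Function.iterate_succ_apply' _ (n + 1), 
      Finset.sum_range_succ (fun i => φ ((d : ℝ) ^ i * θ) / Eseq a i) (n + 1),
      Finset.sum_range_succ (fun i =>
        (fn a d φ α (i + 1) θ X - (qm a)^[i + 1] 0) ^ 2 / Eseq a (i + 1)) n]
    set u := fn a d φ α (n + 1) θ X
    set x := (qm a)^[n + 1] 0
    set S := ∑ i ∈ Finset.range (n + 1), φ ((d : ℝ) ^ i * θ) / Eseq a i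
    set S' := ∑ i ∈ Finset.range n,
          (fn a d φ α (i + 1) θ X - (qm a)^[i + 1] 0) ^ 2 / Eseq a (i + 1)
    have e : Eseq a (n + 1) * (α * (S + φ ((d : ℝ) ^ (n + 1) * θ) / Eseq a (n + 1)) - X ^ 2 -
        (S' + (u - x) ^ 2 / Eseq a (n + 1))) =
        Eseq a (n + 1) * (α * S - X ^ 2 - S') + α * φ ((d : ℝ) ^ (n + 1) * θ) - (u - x) ^ 2 := by
      field_simp
      ring
    rw [e, Eseq_succ]
    change qm a u + _ - qm a x = _
    simp only [qm]
    linear_combination (-2 * x) * ih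

lemma tser_approx {c σ C : ℝ} (hφb : ∀ θ : ℝ, |φ θ| ≤ 1) (hξ₀ : 0 < ξ₀)
    (hx : ∀ n, 2 * ξ₀ ≤ |(qm a)^[n + 1] 0|)
    (hE0 : ∀ i, Eseq a i ≠ 0) (hc : 0 < c) (hσ : 1 < σ)
    (hg : ∀ n l, c * σ ^ l * |Eseq a n| ≤ |Eseq a (n + l)|) (hα : 0 < α) {θ X : ℝ}
    (hX : X ^ 2 ≤ α) {n : ℕ} (hlen : ∀ i ≤ n, len a α i ≤ C * α * |Eseq a i|) :
    |(fn a d φ α (n + 1) θ X - (qm a)^[n + 1] 0) / (α * Eseq a n) - tser φ d (Eseq a) θ| ≤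
      1 / (c * (1 - σ⁻¹)) / |Eseq a (n + 1)| + X ^ 2 / α +
        C ^ 2 * (1 / (c * (1 - σ⁻¹))) / (4 * ξ₀) * (α * |Eseq a n|) := by
  set C' := 1 / (c * (1 - σ⁻¹))
  obtain ⟨hs0, -⟩ := tail_inv_bound hE0 hc hσ hg 0
  simp only [zero_add] at hs0
  obtain ⟨hs, hb⟩ := tail_inv_bound hE0 hc hσ hg (n + 1)
  rw [fn_sub_orbit hE0, tser_split hφb hs0 (n + 1)]
  set S := ∑ i ∈ Finset.range (n + 1), φ ((d : ℝ) ^ i * θ) / Eseq a i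
  set S' := ∑ i ∈ Finset.range n,
          (fn a d φ α (i + 1) θ X - (qm a)^[i + 1] 0) ^ 2 / Eseq a (i + 1) with hS'
  set R := tser φ d (fun i => Eseq a (n + 1 + i)) ((d : ℝ) ^ (n + 1) * θ) with hR
  have hEn := hE0 n
  have e : Eseq a n * (α * S - X ^ 2 - S') / (α * Eseq a n) - (S + R) =
      -R - X ^ 2 / α - S' / α := by
    field_simp
    ring
  rw [e]
  have hRb : |R| ≤ C' / |Eseq a (n + 1)| := by
    refine le_trans ?_ hb
    rw [hR, tser, ← Real.norm_eq_abs]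
    exact tsum_of_norm_bounded hs.hasSum fun i =>
      tser_term_bound (d := d) (E := fun i => Eseq a (n + 1 + i)) hφb ((d : ℝ) ^ (n + 1) * θ) i
  have hterm : ∀ i ∈ Finset.range n,
      |(fn a d φ α (i + 1) θ X - (qm a)^[i + 1] 0) ^ 2 / Eseq a (i + 1)| ≤
        C ^ 2 * α ^ 2 / (4 * ξ₀) * |Eseq a i| := by
    intro i hi
    have h1 := (abs_sub_le_len (fn_mem_IEnd (a := a) (d := d) (θ := θ) hφb hα hX i)
      (orbit_mem_IEnd hα i)).trans (hlen i (Finset.mem_range.1 hi).le)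
    have hEi : 0 < |Eseq a i| := abs_pos.2 (hE0 i)
    rw [abs_div, abs_pow, Eseq_succ, abs_mul, abs_mul, abs_neg, abs_two]
    have h2 := hx i
    calc _ ≤ (C * α * |Eseq a i|) ^ 2 / (|Eseq a i| * (2 * (2 * ξ₀))) := by gcongr
      _ = _ := by field_simp; ring
  have hS'b : |S'| ≤ C ^ 2 * α ^ 2 / (4 * ξ₀) * (C' * |Eseq a n|) := by
    calc |S'| ≤ ∑ i ∈ Finset.range n, C ^ 2 * α ^ 2 / (4 * ξ₀) * |Eseq a i| :=
          (Finset.abs_sum_le_sum_abs _ _).trans (Finset.sum_le_sum hterm)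
      _ ≤ ∑ i ∈ Finset.range (n + 1), C ^ 2 * α ^ 2 / (4 * ξ₀) * |Eseq a i| :=
          Finset.sum_le_sum_of_subset_of_nonneg (Finset.range_mono (by omega))
            fun i _ _ => by positivity
      _ ≤ _ := by
          rw [← Finset.mul_sum]
          gcongr
          exact sum_abs_le hc hσ hg n
  have hS'2 : |S' / α| ≤ C ^ 2 * C' / (4 * ξ₀) * (α * |Eseq a n|) := by
    rw [abs_div, abs_of_pos hα, div_le_iff₀ hα]
    refine hS'b.trans (le_of_eq ?_)
    ring
  have hX0 : |X ^ 2 / α| = X ^ 2 / α := abs_of_nonneg (by positivity)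
  calc |-R - X ^ 2 / α - S' / α| ≤ |-R| + |X ^ 2 / α| + |S' / α| :=
        (abs_sub _ _).trans (by gcongr; exact abs_sub _ _)
    _ ≤ _ := by rw [abs_neg, hX0]; gcongr

/-- Backward contraction (up to a bounded factor) along orbits shadowing the critical orbit. -/
lemma fn_sub_backward (hφb : ∀ θ : ℝ, |φ θ| ≤ 1) (hα : 0 < α) (hξ₀ : 0 < ξ₀)
    (hx : ∀ n, 2 * ξ₀ ≤ |(qm a)^[n + 1] 0|) {κ : ℝ} (hκ1 : 1 ≤ κ) (hκ : 1 / (2 * ξ₀) ≤ κ)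
    {θ θ' X X' : ℝ} (hX : X ^ 2 ≤ α) (hX' : X' ^ 2 ≤ α) (n l : ℕ)
    (hlt : ∀ i < n + l, len a α i < ξ₀) :
    |fn a d φ α (n + 1) θ X - fn a d φ α (n + 1) θ' X'| ≤
      κ ^ l * (|fn a d φ α (n + l + 1) θ X - fn a d φ α (n + l + 1) θ' X'| + 2 * α * l) := by
  induction l with
  | zero => simp
  | succ l ih =>
    refine (ih fun i hi => hlt i (by omega)).trans ?_
    set y := fn a d φ α (n + l + 1) θ X with hy
    set y' := fn a d φ α (n + l + 1) θ' X' with hy'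
    have h1 := (abs_sub_le_len (fn_mem_IEnd (a := a) (d := d) (θ := θ) hφb hα hX (n + l))
      (orbit_mem_IEnd hα (n + l)))
    have h2 := (abs_sub_le_len (fn_mem_IEnd (a := a) (d := d) (θ := θ') hφb hα hX' (n + l))
      (orbit_mem_IEnd hα (n + l)))
    have h3 := hlt (n + l) (by omega)
    have h4 := hx (n + l)
    rw [← hy] at h1
    rw [← hy'] at h2
    have h5 : 2 * ξ₀ ≤ |y + y'| := by
      set x := (qm a)^[n + l + 1] 0
      have h6 : |2 * x| ≤ |y + y'| + (|y - x| + |y' - x|) := by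
        rw [show 2 * x = (y + y') - ((y - x) + (y' - x)) by ring]
        exact (abs_sub _ _).trans (by gcongr; exact abs_add_le _ _)
      rw [abs_mul, abs_two] at h6
      linarith
    have e : fn a d φ α (n + (l + 1) + 1) θ X - fn a d φ α (n + (l + 1) + 1) θ' X' =
        -((y + y') * (y - y')) +
          α * (φ ((d : ℝ) ^ (n + l + 1) * θ) - φ ((d : ℝ) ^ (n + l + 1) * θ')) := by
      rw [show n + (l + 1) + 1 = n + l + 1 + 1 by ring, fn_succ (n + l + 1) θ X,
        fn_succ (n + l + 1) θ' X', ← hy, ← hy']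
      simp only [qm]
      ring
    set D := fn a d φ α (n + (l + 1) + 1) θ X - fn a d φ α (n + (l + 1) + 1) θ' X'
    have h7 : |y + y'| * |y - y'| ≤ |D| + 2 * α := by
      have h8 : (y + y') * (y - y') = α * (φ ((d : ℝ) ^ (n + l + 1) * θ) -
        φ ((d : ℝ) ^ (n + l + 1) * θ')) - D := by rw [e]; ring
      rw [← abs_mul, h8]
      refine (abs_sub _ _).trans ?_
      rw [abs_mul, abs_of_pos hα]
      have h9 : |φ ((d : ℝ) ^ (n + l + 1) * θ) - φ ((d : ℝ) ^ (n + l + 1) * θ')| ≤ 2 := by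
        refine (abs_sub _ _).trans ?_
        linarith [hφb ((d : ℝ) ^ (n + l + 1) * θ), hφb ((d : ℝ) ^ (n + l + 1) * θ')]
      linarith [mul_le_mul_of_nonneg_left h9 hα.le]
    have h10 : |y - y'| ≤ κ * (|D| + 2 * α) := by
      have h11 : |y - y'| ≤ 1 / (2 * ξ₀) * (|D| + 2 * α) := by
        rw [one_div_mul_eq_div, le_div_iff₀ (by positivity)]
        nlinarith [abs_nonneg (y - y')]
      exact h11.trans (by gcongr)
    have hκl : 0 ≤ κ ^ l := by positivity
    calc κ ^ l * (|y - y'| + 2 * α * l) ≤ κ ^ l * (κ * (|D| + 2 * α) + κ * (2 * α * l)) := by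
          exact mul_le_mul_of_nonneg_left
            (add_le_add h10 (le_mul_of_one_le_left (by positivity) hκ1)) hκl
      _ = _ := by push_cast; ring

set_option maxHeartbeats 1000000 in
/-- Two orbits starting near the critical point which are close at time `N(α)` come from points
where the series takes close values. -/
lemma tser_close_of_fn_close {c σ : ℝ} (hφb : ∀ θ : ℝ, |φ θ| ≤ 1) (hξ₀ : 0 < ξ₀)
    (hx : ∀ n, 2 * ξ₀ ≤ |(qm a)^[n + 1] 0|) (hx2 : ∀ n, |(qm a)^[n + 1] 0| ≤ 2)
    (hE0 : ∀ i, Eseq a i ≠ 0) (hc : 0 < c) (hσ : 1 < σ)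
    (hg : ∀ n l, c * σ ^ l * |Eseq a n| ≤ |Eseq a (n + l)|) {τ : ℝ} (hτ : 0 < τ) :
    ∃ ρ : ℝ, 0 < ρ ∧ ∀ᶠ α in nhdsWithin (0 : ℝ) (Ioi 0), ∀ θ θ' X X' : ℝ,
      X ^ 2 ≤ 4 * α ^ (1.2 : ℝ) → X' ^ 2 ≤ 4 * α ^ (1.2 : ℝ) →
      |fn a d φ α (Nal a ξ₀ α) θ X - fn a d φ α (Nal a ξ₀ α) θ' X'| ≤ ρ →
      |tser φ d (Eseq a) θ - tser φ d (Eseq a) θ'| ≤ τ := by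
  obtain ⟨C, c₃, hC, hc₃, hN⟩ := Nal_bounds hξ₀ hx hE0 hc hσ hg
  have h1σ : 0 < 1 - σ⁻¹ := by linarith [inv_lt_one_of_one_lt₀ hσ]
  set C' := 1 / (c * (1 - σ⁻¹)) with hC'
  have hC'0 : 0 < C' := by positivity
  set K := C ^ 2 * C' / (4 * ξ₀) with hK
  have hK0 : 0 < K := by positivity
  obtain ⟨l, hl⟩ := pow_unbounded_of_one_lt (2 * (K * (ξ₀ / (3 * c))) / (τ / 3)) hσ
  rw [div_lt_iff₀ (by positivity)] at hl
  set κ := max 1 (1 / (2 * ξ₀)) with hκ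
  have hκ1 : 1 ≤ κ := le_max_left _ _
  have hκ0 : 0 < κ := by linarith
  have h4 : ∀ n k, |Eseq a (n + k)| ≤ 4 ^ k * |Eseq a n| := by
    intro n k
    induction k with
    | zero => simp
    | succ k ih =>
      rw [← add_assoc, Eseq_succ, abs_mul, abs_mul, abs_neg, abs_two, pow_succ]
      have := hx2 (n + k)
      calc _ ≤ (4 ^ k * |Eseq a n|) * (2 * 2) := by gcongr
        _ = _ := by ring
  set ρ := τ / 3 / (κ ^ l * (4 ^ (l + 1) / c₃)) with hρ
  refine ⟨ρ, by positivity, ?_⟩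
  set G : ℝ → ℝ := fun α => 2 * (C' * (4 ^ l * α / c₃) + 4 * α ^ (0.2 : ℝ)) +
    κ ^ l * (2 * α * l) * (4 ^ (l + 1) / c₃) with hG
  have hrpow : Continuous fun α : ℝ => α ^ (0.2 : ℝ) := Real.continuous_rpow_const (by norm_num)
  have hGc : Continuous G := by fun_prop
  have hG0 : G 0 = 0 := by
    simp only [hG]; rw [Real.zero_rpow (by norm_num)]; simp
  have ev1 : ∀ᶠ α in nhdsWithin (0 : ℝ) (Ioi 0), G α < τ / 3 :=
    nhdsWithin_le_nhds (hGc.continuousAt.eventually_lt continuousAt_const (by rw [hG0]; positivity))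
  have ev2 : ∀ᶠ α in nhdsWithin (0 : ℝ) (Ioi 0), α * 4 ^ (l + 1) < c₃ :=
    nhdsWithin_le_nhds ((by fun_prop : Continuous fun α : ℝ => α * 4 ^ (l + 1)).continuousAt.eventually_lt
      continuousAt_const (by simpa using hc₃))
  have ev3 : ∀ᶠ α in nhdsWithin (0 : ℝ) (Ioi 0), 4 * α ^ (0.2 : ℝ) < 1 :=
    nhdsWithin_le_nhds ((by fun_prop : Continuous fun α : ℝ => 4 * α ^ (0.2 : ℝ)).continuousAt.eventually_lt
      continuousAt_const (by rw [Real.zero_rpow (by norm_num)]; norm_num))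
  filter_upwards [ev1, ev2, ev3, self_mem_nhdsWithin] with α hα1 hα2 hα3 hα θ θ' X X' hX hX' hclose
  replace hα : 0 < α := hα
  obtain ⟨hN1, hN2, hN3⟩ := hN α hα
  obtain ⟨hlt, -, -⟩ := Nal_spec (a := a) hα hξ₀
  set N := Nal a ξ₀ α
  have h12 : α ^ (1.2 : ℝ) = α * α ^ (0.2 : ℝ) := by
    rw [show (1.2 : ℝ) = 1 + 0.2 by norm_num, Real.rpow_add hα, Real.rpow_one]
  have hXα : ∀ X : ℝ, X ^ 2 ≤ 4 * α ^ (1.2 : ℝ) → X ^ 2 ≤ α ∧ X ^ 2 / α ≤ 4 * α ^ (0.2 : ℝ) := by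
    intro X hX
    rw [h12] at hX
    refine ⟨by nlinarith, ?_⟩
    rw [div_le_iff₀ hα]
    linarith
  have hNl : l + 1 < N := by
    by_contra! hcon
    have h5 : |Eseq a N| ≤ 4 ^ (l + 1) := by
      have := h4 0 N
      rw [zero_add, Eseq_zero, abs_one, mul_one] at this
      exact this.trans (pow_le_pow_right₀ (by norm_num) hcon)
    have : α * |Eseq a N| ≤ α * 4 ^ (l + 1) := by gcongr
    linarith
  obtain ⟨n, hNn⟩ : ∃ n, N = n + l + 1 := ⟨N - l - 1, by omega⟩
  have hEn : 0 < |Eseq a n| := abs_pos.2 (hE0 n)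
  have hEn1 : 0 < |Eseq a (n + 1)| := abs_pos.2 (hE0 (n + 1))
  have b1 : 1 / |Eseq a (n + 1)| ≤ 4 ^ l * α / c₃ := by
    have h5 := h4 (n + 1) l
    rw [show n + 1 + l = N by omega] at h5
    rw [div_le_div_iff₀ hEn1 hc₃]
    nlinarith
  have b2 : 1 / (α * |Eseq a n|) ≤ 4 ^ (l + 1) / c₃ := by
    have h5 := h4 n (l + 1)
    rw [show n + (l + 1) = N by omega] at h5
    rw [div_le_div_iff₀ (by positivity) hc₃]
    nlinarith
  have b3 : α * |Eseq a n| ≤ ξ₀ / (3 * c) / σ ^ l := by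
    have h5 := hg n l
    have h6 := hN2 (n + l) (by omega)
    rw [div_div, le_div_iff₀ (by positivity)]
    nlinarith
  have hlen : ∀ i ≤ n, len a α i ≤ C * α * |Eseq a i| := fun i hi => hN1 i (by omega)
  have hKl : K * (α * |Eseq a n|) * 2 ≤ τ / 3 := by
    have hσl : 0 < σ ^ l := by positivity
    calc K * (α * |Eseq a n|) * 2 ≤ K * (ξ₀ / (3 * c) / σ ^ l) * 2 := by gcongr
      _ = (2 * (K * (ξ₀ / (3 * c)))) / σ ^ l := by ring
      _ ≤ τ / 3 := by rw [div_le_iff₀ hσl]; linarith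
  have err : ∀ θ X : ℝ, X ^ 2 ≤ 4 * α ^ (1.2 : ℝ) →
      |(fn a d φ α (n + 1) θ X - (qm a)^[n + 1] 0) / (α * Eseq a n) - tser φ d (Eseq a) θ| ≤
        C' * (4 ^ l * α / c₃) + 4 * α ^ (0.2 : ℝ) + K * (α * |Eseq a n|) := by
    intro θ X hX
    refine (tser_approx hφb hξ₀ hx hE0 hc hσ hg hα (hXα X hX).1 hlen).trans ?_
    have h5 := (hXα X hX).2
    have h6 : C' / |Eseq a (n + 1)| ≤ C' * (4 ^ l * α / c₃) := by
      rw [← mul_one_div]; gcongr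
    gcongr
  have hback := fn_sub_backward (d := d) (θ := θ) (θ' := θ') hφb hα hξ₀ hx hκ1 (le_max_right _ _)
    (hXα X hX).1 (hXα X' hX').1 n l fun i hi => hlt i (by omega)
  rw [← hNn] at hback
  have hΔ : |(fn a d φ α (n + 1) θ X - (qm a)^[n + 1] 0) / (α * Eseq a n) -
      (fn a d φ α (n + 1) θ' X' - (qm a)^[n + 1] 0) / (α * Eseq a n)| ≤
      κ ^ l * (ρ + 2 * α * l) * (4 ^ (l + 1) / c₃) := by
    rw [← sub_div, sub_sub_sub_cancel_right, abs_div, abs_mul, abs_of_pos hα, ← mul_one_div]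
    gcongr
    exact hback.trans (by gcongr)
  have hρ2 : κ ^ l * ρ * (4 ^ (l + 1) / c₃) = τ / 3 := by
    rw [hρ]; field_simp
  have e1 := abs_le.1 (err θ X hX)
  have e2 := abs_le.1 (err θ' X' hX')
  have e3 := abs_le.1 hΔ
  have e4 : κ ^ l * (ρ + 2 * α * l) * (4 ^ (l + 1) / c₃) =
      τ / 3 + κ ^ l * (2 * α * l) * (4 ^ (l + 1) / c₃) := by rw [← hρ2]; ring
  rw [e4] at e3
  simp only [hG] at hα1
  rw [abs_le]
  constructor <;> linarith [e1.1, e1.2, e2.1, e2.2, e3.1, e3.2]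

/-- The preimages of the critical point, together with some spurious points. -/
def preimages (a : ℝ) : ℕ → Finset ℝ
  | 0 => {0}
  | i + 1 => (preimages a i).image (fun z => Real.sqrt (a - z)) ∪
      (preimages a i).image (fun z => -Real.sqrt (a - z))

lemma abs_sub_sqrt_le {y z ρ : ℝ} (hρ : 0 ≤ ρ) (h : |a - y ^ 2 - z| ≤ ρ ^ 2) :
    |(|y| - Real.sqrt (a - z))| ≤ ρ := by
  have hs := Real.sqrt_nonneg (a - z)
  have hy := abs_nonneg y
  have hy2 := sq_abs y
  refine abs_le_of_sq_le_sq ?_ hρ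
  rw [abs_le] at h
  rcases le_total 0 (a - z) with h0 | h0
  · have h1 := Real.sq_sqrt h0
    rcases le_total |y| (Real.sqrt (a - z)) with h2 | h2 <;> nlinarith
  · rw [Real.sqrt_eq_zero_of_nonpos h0] at *
    nlinarith

lemma near_preimages (hφb : ∀ θ : ℝ, |φ θ| ≤ 1) (i : ℕ) : ∀ ρ : ℝ, 0 < ρ →
    ∃ η : ℝ, 0 < η ∧ ∀ α, 0 < α → α < η → ∀ θ y : ℝ, |fn a d φ α i θ y| ≤ η →
      ∃ z ∈ preimages a i, |y - z| ≤ ρ := by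
  induction i with
  | zero =>
    intro ρ hρ
    exact ⟨ρ, hρ, fun α _ _ θ y hy => ⟨0, by simp [preimages], by simpa using hy⟩⟩
  | succ i ih =>
    intro ρ hρ
    obtain ⟨η, hη, h⟩ := ih (ρ ^ 2 / 2) (by positivity)
    refine ⟨min η (ρ ^ 2 / 2), by positivity, fun α hα hαη θ y hy => ?_⟩
    rw [add_comm i 1, fn_add] at hy
    obtain ⟨z, hz, hyz⟩ := h α hα (hαη.trans_le (min_le_left _ _)) _ _
      (hy.trans (min_le_left _ _))
    rw [fn_succ, fn_zero] at hyz
    have h1 : |α * φ ((d : ℝ) ^ 0 * θ)| ≤ ρ ^ 2 / 2 := by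
      rw [abs_mul, abs_of_pos hα]
      exact (mul_le_of_le_one_right hα.le (hφb _)).trans (hαη.le.trans (min_le_right _ _))
    have h2 : |a - y ^ 2 - z| ≤ ρ ^ 2 := by
      rw [abs_le] at *
      simp only [qm] at hyz
      constructor <;> linarith [hyz.1, hyz.2, h1.1, h1.2]
    have h3 := abs_sub_sqrt_le hρ.le h2
    rcases abs_cases y with ⟨hy0, -⟩ | ⟨hy0, -⟩ <;> rw [hy0] at h3
    · exact ⟨Real.sqrt (a - z), Finset.mem_union_left _ (Finset.mem_image_of_mem _ hz), h3⟩
    · refine ⟨-Real.sqrt (a - z), Finset.mem_union_right _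
        (Finset.mem_image_of_mem (fun z => -Real.sqrt (a - z)) hz), ?_⟩
      rwa [sub_neg_eq_add, ← abs_neg, neg_add']

/-- With probability close to one, an orbit starting near the critical point does not come back
within a bounded time after `N(α)`. -/
lemma volume_early_return {c σ : ℝ} (hφc : Continuous φ) (hφb : ∀ θ : ℝ, |φ θ| ≤ 1)
    (hξ₀ : 0 < ξ₀)
    (hx : ∀ n, 2 * ξ₀ ≤ |(qm a)^[n + 1] 0|) (hx2 : ∀ n, |(qm a)^[n + 1] 0| ≤ 2)
    (hE0 : ∀ i, Eseq a i ≠ 0) (hc : 0 < c) (hσ : 1 < σ)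
    (hg : ∀ n l, c * σ ^ l * |Eseq a n| ≤ |Eseq a (n + l)|)
    (hnull : ∀ v, volume ({θ | tser φ d (Eseq a) θ = v} ∩ Icc (0 : ℝ) 1) = 0)
    (M : ℕ) {ε : ℝ≥0∞} (hε : 0 < ε) :
    ∀ᶠ α in nhdsWithin (0 : ℝ) (Ioi 0), ∀ X : ℝ → ℝ,
      (∀ θ ∈ Ico (0 : ℝ) 1, |X θ| ≤ 2 * α ^ (0.6 : ℝ)) →
      volume {θ | θ ∈ Ico (0 : ℝ) 1 ∧ ∃ i ≤ M,
        |fn a d φ α (Nal a ξ₀ α + i) θ (X θ)| ≤ 2 * α ^ (0.6 : ℝ)} ≤ ε := by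
  obtain ⟨hs0, -⟩ := tail_inv_bound hE0 hc hσ hg 0
  simp only [zero_add] at hs0
  set Z : Finset ℝ := (Finset.range (M + 1)).biUnion (preimages a) with hZ
  have hε' : 0 < ε / (Z.card + 1 : ℝ≥0∞) := ENNReal.div_pos hε.ne' (by finiteness)
  obtain ⟨τ, hτ, hτv⟩ := exists_uniform_anticoncentration (tser_continuous hφc hφb hs0) hnull hε'
  obtain ⟨ρ, hρ, hclose⟩ := tser_close_of_fn_close (d := d) hφb hξ₀ hx hx2 hE0 hc hσ hg hτ
  choose! η hη hηp using fun i => near_preimages (a := a) (d := d) hφb i (ρ / 2) (by positivity)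
  have hrpow : Continuous fun α : ℝ => 2 * α ^ (0.6 : ℝ) :=
    continuous_const.mul (Real.continuous_rpow_const (by norm_num))
  have ev : ∀ᶠ α in nhdsWithin (0 : ℝ) (Ioi 0), ∀ i ∈ Finset.range (M + 1),
      α < η i ∧ 2 * α ^ (0.6 : ℝ) < η i := by
    rw [Filter.eventually_all_finset]
    intro i _
    refine nhdsWithin_le_nhds ((continuousAt_id.eventually_lt continuousAt_const (hη i)).and
      (hrpow.continuousAt.eventually_lt continuousAt_const ?_))
    rw [Real.zero_rpow (by norm_num), mul_zero]
    exact hη i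
  filter_upwards [hclose, ev, self_mem_nhdsWithin] with α hcl hev hα X hX
  replace hα : 0 < α := hα
  have hX2 : ∀ θ ∈ Ico (0 : ℝ) 1, X θ ^ 2 ≤ 4 * α ^ (1.2 : ℝ) := by
    intro θ hθ
    have h1 := hX θ hθ
    have h2 : α ^ (1.2 : ℝ) = α ^ (0.6 : ℝ) * α ^ (0.6 : ℝ) := by
      rw [← Real.rpow_add hα]; norm_num
    rw [h2, ← sq_abs]
    have h0 := abs_nonneg (X θ)
    nlinarith
  set N := Nal a ξ₀ α
  have hsub : {θ | θ ∈ Ico (0 : ℝ) 1 ∧ ∃ i ≤ M,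
        |fn a d φ α (N + i) θ (X θ)| ≤ 2 * α ^ (0.6 : ℝ)} ⊆
      ⋃ z ∈ Z, {θ | θ ∈ Ico (0 : ℝ) 1 ∧ |fn a d φ α N θ (X θ) - z| ≤ ρ / 2} := by
    rintro θ ⟨hθ, i, hi, h⟩
    have hi' : i ∈ Finset.range (M + 1) := Finset.mem_range.2 (by omega)
    rw [fn_add] at h
    obtain ⟨z, hz, hyz⟩ := hηp i α hα (hev i hi').1 _ _ (h.trans (hev i hi').2.le)
    exact mem_biUnion (Finset.mem_biUnion.2 ⟨i, hi', hz⟩) ⟨hθ, hyz⟩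
  refine (measure_mono hsub).trans ((measure_biUnion_finset_le _ _).trans ?_)
  calc _ ≤ ∑ z ∈ Z, ε / (Z.card + 1 : ℝ≥0∞) := by
        refine Finset.sum_le_sum fun z _ => ?_
        rcases eq_empty_or_nonempty
          {θ | θ ∈ Ico (0 : ℝ) 1 ∧ |fn a d φ α N θ (X θ) - z| ≤ ρ / 2} with h | ⟨θ', hθ', h'⟩
        · rw [h]; simp
        · refine (measure_mono ?_).trans (hτv (tser φ d (Eseq a) θ'))
          rintro θ ⟨hθ, h⟩
          refine ⟨hθ, hcl θ θ' _ _ (hX2 θ hθ) (hX2 θ' hθ') ?_⟩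
          rw [abs_le] at *
          constructor <;> linarith
    _ ≤ ε := by
        rw [Finset.sum_const, nsmul_eq_mul]
        calc _ ≤ (Z.card + 1 : ℝ≥0∞) * (ε / (Z.card + 1 : ℝ≥0∞)) := by gcongr; exact le_self_add
          _ ≤ ε := ENNReal.mul_div_le

end early

/-! ### Cells of the partition and iterated curves -/

section cells

variable {D : ℕ}

lemma volume_ne_top_of_subset_Ico {S : Set ℝ} (hS : S ⊆ Ico 0 1) : volume S ≠ ∞ :=
  measure_ne_top_of_subset hS (by simp)

lemma measurableSet_of_cells {E : Set ℝ} (hE : E ⊆ Ico 0 1)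
    (hcell : ∀ θ ∈ E, ∀ θ' ∈ Ico (0 : ℝ) 1, ⌊θ' * (D : ℝ)⌋ = ⌊θ * (D : ℝ)⌋ → θ' ∈ E) :
    MeasurableSet E := by
  have h : E = Ico 0 1 ∩ (fun θ : ℝ => ⌊θ * (D : ℝ)⌋) ⁻¹' ((fun θ : ℝ => ⌊θ * (D : ℝ)⌋) '' E) := by
    ext θ
    constructor
    · exact fun hθ => ⟨hE hθ, mem_image_of_mem _ hθ⟩
    · rintro ⟨hθ, θ', hθ', h⟩
      exact hcell θ' hθ' θ hθ h.symm
  rw [h]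
  exact measurableSet_Ico.inter
    (Int.measurable_floor.comp (measurable_id.mul_const _) (MeasurableSet.of_discrete))

lemma exists_cell (hD : 0 < D) {θ : ℝ} (hθ : θ ∈ Ico (0 : ℝ) 1) :
    ∃ j < D, ∃ t ∈ Ico (0 : ℝ) 1, θ = (t + j) / D := by
  have hD' : (0 : ℝ) < D := by exact_mod_cast hD
  have h0 : 0 ≤ θ * D := mul_nonneg hθ.1 hD'.le
  refine ⟨⌊θ * D⌋₊, ?_, θ * D - ⌊θ * D⌋₊, ⟨?_, ?_⟩, ?_⟩
  · rw [Nat.floor_lt h0]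
    nlinarith [hθ.2]
  · linarith [Nat.floor_le h0]
  · linarith [Nat.lt_floor_add_one (θ * (D : ℝ))]
  · field_simp
    ring

lemma cell_mem {j : ℕ} (hj : j < D) {t : ℝ} (ht : t ∈ Ico (0 : ℝ) 1) :
    (t + j) / (D : ℝ) ∈ Ico (0 : ℝ) 1 := by
  have hD' : (0 : ℝ) < D := by exact_mod_cast (Nat.zero_le j).trans_lt hj
  have hj' : (j : ℝ) + 1 ≤ D := by exact_mod_cast hj
  have h0 : (0 : ℝ) ≤ j := j.cast_nonneg
  exact ⟨div_nonneg (add_nonneg ht.1 h0) hD'.le, by rw [div_lt_one hD']; linarith [ht.2]⟩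

lemma floor_cell (hD : 0 < D) {j : ℕ} {t : ℝ} (ht : t ∈ Ico (0 : ℝ) 1) :
    ⌊(t + j) / (D : ℝ) * D⌋ = j := by
  have hD' : (D : ℝ) ≠ 0 := by exact_mod_cast hD.ne'
  rw [div_mul_cancel₀ _ hD', Int.floor_eq_iff]
  push_cast
  exact ⟨by linarith [ht.1], by linarith [ht.2]⟩

/-- A set whose trace on each cell of a union `E` of cells has relative (outer) measure at most `g`
has measure at most `g` times that of `E`. -/
lemma volume_le_of_cells (hD : 0 < D) {E S : Set ℝ} {g : ℝ} (hg : 0 ≤ g) (hE : E ⊆ Ico 0 1)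
    (hcell : ∀ θ ∈ E, ∀ θ' ∈ Ico (0 : ℝ) 1, ⌊θ' * (D : ℝ)⌋ = ⌊θ * (D : ℝ)⌋ → θ' ∈ E)
    (hSE : S ⊆ E)
    (h : ∀ j < D, ∀ t₀ ∈ Ico (0 : ℝ) 1, (t₀ + j) / (D : ℝ) ∈ E →
      volume.real {t | t ∈ Ico (0 : ℝ) 1 ∧ (t + j) / (D : ℝ) ∈ S} ≤ g) :
    volume.real S ≤ volume.real E * g := by
  classical
  have hD' : (0 : ℝ) < D := by exact_mod_cast hD
  set J := (Finset.range D).filter fun j : ℕ => ∃ t ∈ Ico (0 : ℝ) 1, (t + j) / (D : ℝ) ∈ E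
  have hEle : (J.card : ℝ) / D ≤ volume.real E := by
    have hsub : ⋃ j ∈ J, Ico ((j : ℝ) / D) ((j + 1 : ℝ) / D) ⊆ E := by
      refine iUnion₂_subset fun j hj θ hθ => ?_
      obtain ⟨hj, t, ht, hmem⟩ := Finset.mem_filter.1 hj
      have ht' : θ * D - j ∈ Ico (0 : ℝ) 1 := by
        rw [mem_Ico, div_le_iff₀ hD', lt_div_iff₀ hD'] at hθ
        exact ⟨by linarith [hθ.1], by linarith [hθ.2]⟩
      have e : θ = (θ * D - j + j) / (D : ℝ) := by field_simp; ring
      rw [e]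
      refine hcell _ hmem _ (cell_mem (Finset.mem_range.1 hj) ht') ?_
      rw [floor_cell hD ht', floor_cell hD ht]
    have hdisj : PairwiseDisjoint (J : Set ℕ) fun j : ℕ => Ico ((j : ℝ) / D) ((j + 1 : ℝ) / D) := by
      intro i _ j _ hij
      refine Set.disjoint_left.2 fun θ hi hj => hij ?_
      rw [mem_Ico, div_le_iff₀ hD', lt_div_iff₀ hD'] at hi hj
      have h1 : (i : ℝ) < j + 1 := by linarith [hi.1, hj.2]
      have h2 : (j : ℝ) < i + 1 := by linarith [hj.1, hi.2]
      have h1' : i < j + 1 := by exact_mod_cast h1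
      have h2' : j < i + 1 := by exact_mod_cast h2
      omega
    refine le_trans (le_of_eq ?_) (measureReal_mono hsub (volume_ne_top_of_subset_Ico hE))
    rw [measureReal_biUnion_finset hdisj (fun j _ => measurableSet_Ico) (by simp)]
    have : ∀ j ∈ J, volume.real (Ico ((j : ℝ) / D) ((j + 1 : ℝ) / D)) = 1 / D := by
      intro j _
      rw [Real.volume_real_Ico_of_le (by gcongr; linarith)]
      ring
    rw [Finset.sum_congr rfl this, Finset.sum_const, nsmul_eq_mul, mul_one_div]
  have hSsub : S ⊆ ⋃ j ∈ J, (fun θ : ℝ => θ * D) ⁻¹' ((fun s : ℝ => s + (-(j : ℝ))) ⁻¹'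
      {t | t ∈ Ico (0 : ℝ) 1 ∧ (t + j) / (D : ℝ) ∈ S}) := by
    intro θ hθ
    obtain ⟨j, hj, t, ht, rfl⟩ := exists_cell hD (hE (hSE hθ))
    refine mem_biUnion (Finset.mem_filter.2 ⟨Finset.mem_range.2 hj, t, ht, hSE hθ⟩) ?_
    simp only [mem_preimage]
    rw [div_mul_cancel₀ _ hD'.ne', add_neg_cancel_right]
    exact ⟨ht, hθ⟩
  have hvol : ∀ T : Set ℝ, ∀ c : ℝ, volume ((fun θ : ℝ => θ * D) ⁻¹' ((fun s : ℝ => s + c) ⁻¹' T)) =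
      ENNReal.ofReal (1 / D) * volume T := by
    intro T c
    rw [Real.volume_preimage_mul_right hD'.ne', measure_preimage_add_right, abs_of_pos (by positivity),
      one_div]
  have hT : ∀ j : ℕ, volume {t | t ∈ Ico (0 : ℝ) 1 ∧ (t + j) / (D : ℝ) ∈ S} ≠ ∞ :=
    fun j => volume_ne_top_of_subset_Ico fun t ht => ht.1
  have hvr : ∀ T : Set ℝ, ∀ c : ℝ,
      volume.real ((fun θ : ℝ => θ * D) ⁻¹' ((fun s : ℝ => s + c) ⁻¹' T)) =
        1 / D * volume.real T := by
    intro T c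
    rw [measureReal_def, hvol, ENNReal.toReal_mul, ENNReal.toReal_ofReal (by positivity),
      measureReal_def]
  calc volume.real S ≤ _ := measureReal_mono hSsub (by
        refine ((measure_biUnion_finset_le _ _).trans_lt ?_).ne
        refine ENNReal.sum_lt_top.2 fun j _ => ?_
        rw [hvol]
        exact ENNReal.mul_lt_top ENNReal.ofReal_lt_top (hT j).lt_top)
    _ ≤ _ := measureReal_biUnion_finset_le _ _
    _ ≤ ∑ j ∈ J, 1 / D * g := by
        refine Finset.sum_le_sum fun j hj => ?_
        obtain ⟨hj, t, ht, hmem⟩ := Finset.mem_filter.1 hj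
        rw [hvr]
        exact mul_le_mul_of_nonneg_left (h j (Finset.mem_range.1 hj) t ht hmem) (by positivity)
    _ = J.card / D * g := by rw [Finset.sum_const, nsmul_eq_mul]; ring
    _ ≤ _ := mul_le_mul_of_nonneg_right hEle hg

end cells

section curves

variable {a β α : ℝ} {d : ℕ} {φ : ℝ → ℝ}

/-- The curve obtained by iterating `n` times the part of `X` over the `j`-th element of the
partition `𝒫_n`. -/
def cellCurve (a : ℝ) (d : ℕ) (φ : ℝ → ℝ) (α : ℝ) (X : ℝ → ℝ) (n j : ℕ) (t : ℝ) : ℝ :=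
  fn a d φ α n ((t + j) / ((d ^ n : ℕ) : ℝ)) (X ((t + j) / ((d ^ n : ℕ) : ℝ)))

lemma Admissible.cellCurve (hd : 2 ≤ d) (hφp : Function.Periodic φ 1) {n₀ : ℕ} {X : ℝ → ℝ}
    (hX : Admissible a d φ α β n₀ X) {n j : ℕ} (hj : j < d ^ n) :
    Admissible a d φ α β n₀ (cellCurve a d φ α X n j) := by
  obtain ⟨n', hn', j', hj', x₀, hx₀, h⟩ := hX
  have hd0 : (d : ℝ) ≠ 0 := by positivity
  refine ⟨n' + n, by omega, j + d ^ n * j', ?_, x₀, hx₀, fun t ht => ?_⟩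
  · have : d ^ n * (j' + 1) ≤ d ^ n * d ^ n' := Nat.mul_le_mul_left _ hj'
    rw [pow_add, mul_comm (d ^ n')]
    linarith
  · rw [_root_.cellCurve, h _ (cell_mem hj ht), fn_add,
      show (d : ℝ) ^ n' * ((t + ((j + d ^ n * j' : ℕ) : ℝ)) / (d : ℝ) ^ (n' + n)) =
        (t + j) / ((d ^ n : ℕ) : ℝ) + ((j' : ℤ) : ℝ) by push_cast; field_simp; ring,
      fn_add_int hφp]
    congr 2
    push_cast
    field_simp
    ring

lemma isRet_cellCurve_iff (hd : 2 ≤ d) (hφp : Function.Periodic φ 1) {X : ℝ → ℝ} {n j : ℕ}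
    (hj : j < d ^ n) {t : ℝ} (ht : t ∈ Ico (0 : ℝ) 1) {m : ℕ} (hm : 1 ≤ m) :
    IsRet a d φ α X ((t + j) / ((d ^ n : ℕ) : ℝ)) (n + m) ↔
      IsRet a d φ α (cellCurve a d φ α X n j) t m := by
  have hdn : 0 < d ^ n := by positivity
  have hdm : d ^ m ≠ 0 := by positivity
  have hd0 : (d : ℝ) ≠ 0 := by positivity
  have hfn : ∀ s : ℝ, fn a d φ α (n + m) ((s + j) / ((d ^ n : ℕ) : ℝ))
      (X ((s + j) / ((d ^ n : ℕ) : ℝ))) = fn a d φ α m s (cellCurve a d φ α X n j s) := by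
    intro s
    rw [fn_add, show (d : ℝ) ^ n * ((s + j) / ((d ^ n : ℕ) : ℝ)) = s + ((j : ℤ) : ℝ) by
      push_cast; field_simp, fn_add_int hφp]
    rfl
  have hfl : ∀ s : ℝ, ⌊(s + j) / ((d ^ n : ℕ) : ℝ) * (d : ℝ) ^ (n + m)⌋ =
      ⌊s * (d : ℝ) ^ m⌋ + ((j * d ^ m : ℕ) : ℤ) := by
    intro s
    rw [← Int.floor_add_natCast]
    congr 1
    push_cast
    field_simp
    ring
  have hn : n + m ≠ 0 := by omega
  have hm0 : m ≠ 0 := by omega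
  have hn1 : 1 ≤ n + m := by omega
  simp only [IsRet, hn, hm0, hn1, hm, true_and, false_or]
  constructor
  · rintro ⟨θ', hθ', h, hle⟩
    obtain ⟨i, hi, s, hs, rfl⟩ := exists_cell hdn hθ'
    have hij : i = j := by
      have key : ∀ r : ℝ, ⌊r * (d : ℝ) ^ (n + m)⌋ / ((d ^ m : ℕ) : ℤ) = ⌊r * ((d ^ n : ℕ) : ℝ)⌋ := by
        intro r
        rw [← Int.mul_natCast_floor_div_cancel hdm (r * ((d ^ n : ℕ) : ℝ))]
        congr 2
        push_cast
        ring
      have h1 := key ((s + i) / ((d ^ n : ℕ) : ℝ))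
      rw [h, key, floor_cell hdn ht, floor_cell hdn hs] at h1
      exact_mod_cast h1.symm
    subst hij
    rw [hfl, hfl] at h
    exact ⟨s, hs, by linarith, by rwa [hfn] at hle⟩
  · rintro ⟨s, hs, h, hle⟩
    exact ⟨_, cell_mem hj hs, by rw [hfl, hfl, h], by rwa [hfn]⟩

lemma isRet_congr (hd : 2 ≤ d) {X : ℝ → ℝ} {θ θ' : ℝ} {n m : ℕ} (hmn : m ≤ n)
    (h : ⌊θ' * ((d ^ n : ℕ) : ℝ)⌋ = ⌊θ * ((d ^ n : ℕ) : ℝ)⌋) :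
    IsRet a d φ α X θ' m ↔ IsRet a d φ α X θ m := by
  obtain ⟨k, rfl⟩ := Nat.exists_eq_add_of_le hmn
  have hdk : d ^ k ≠ 0 := by positivity
  have key : ∀ r : ℝ, ⌊r * ((d ^ (m + k) : ℕ) : ℝ)⌋ / ((d ^ k : ℕ) : ℤ) = ⌊r * (d : ℝ) ^ m⌋ := by
    intro r
    rw [← Int.mul_natCast_floor_div_cancel hdk (r * (d : ℝ) ^ m)]
    congr 2
    push_cast
    ring
  have h1 := key θ'
  rw [h, key] at h1
  simp only [IsRet, h1]

lemma invariant_small (hβ1 : 1 < β) (hβmap : ∀ x ∈ Icc (-β) β, qm a x ∈ Ioo (-β) β) :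
    ∃ δ : ℝ, 0 < δ ∧ ∀ x ∈ Icc (-β) β, ∀ t : ℝ, |t| ≤ δ → qm a x + t ∈ Icc (-β) β := by
  have h0 := hβmap 0 ⟨by linarith, by linarith⟩
  have h1 := hβmap β ⟨by linarith, le_rfl⟩
  simp only [qm, mem_Ioo] at h0 h1
  refine ⟨min (β - a) (a - β ^ 2 + β), lt_min (by linarith) (by linarith), fun x hx t ht => ?_⟩
  have h2 := (abs_le.1 (ht.trans (min_le_left _ _)))
  have h3 := (abs_le.1 (ht.trans (min_le_right _ _)))
  have h4 : x ^ 2 ≤ β ^ 2 := sq_le_sq' hx.1 hx.2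
  simp only [qm, mem_Icc]
  constructor
  · linarith [h3.1]
  · nlinarith [h2.2]

/-- The curves `θ ↦ f_n(θ, x)` are Lipschitz with constant of order `α dⁿ`. -/
lemma fn_lipschitz {L C₁ R₁ : ℝ} (hd : 2 ≤ d) (hα : 0 < α) (hφb : ∀ θ : ℝ, |φ θ| ≤ 1)
    (hL : ∀ x y, |φ x - φ y| ≤ L * |x - y|)
    (hinv : ∀ x ∈ Icc (-β) β, ∀ t : ℝ, |t| ≤ α → qm a x + t ∈ Icc (-β) β)
    (hC₁ : 0 < C₁) (hR : R₁ ∈ Ioo (0 : ℝ) 2)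
    (hder : ∀ θ x : ℝ, x ∈ Icc (-β) β → ∀ k : ℕ, |deriv (fun y => fn a d φ α k θ y) x| ≤ C₁ * R₁ ^ k)
    (n : ℕ) : ∀ θ θ' x : ℝ, x ∈ Icc (-β) β → |fn a d φ α n θ x - fn a d φ α n θ' x| ≤
      α * (L * C₁ * (((d : ℝ) ^ n - R₁ ^ n) / (d - R₁))) * |θ - θ'| := by
  have hd2 : (2 : ℝ) ≤ d := by exact_mod_cast hd
  have hdR : 0 < (d : ℝ) - R₁ := by linarith [hR.2]
  have hR0 := hR.1
  induction n with
  | zero => intro θ θ' x _; simp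
  | succ n ih =>
    intro θ θ' x hx
    rw [add_comm n 1, fn_add, fn_add]
    have hmem : ∀ θ, fn a d φ α 1 θ x ∈ Icc (-β) β := by
      intro θ
      rw [fn_succ, fn_zero]
      refine hinv x hx _ ?_
      rw [abs_mul, abs_of_pos hα]
      exact mul_le_of_le_one_right hα.le (hφb _)
    have h1 : |fn a d φ α 1 θ x - fn a d φ α 1 θ' x| ≤ α * (L * |θ - θ'|) := by
      rw [fn_succ, fn_succ, fn_zero, fn_zero, add_sub_add_left_eq_sub, ← mul_sub, abs_mul,
        abs_of_pos hα]
      gcongr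
      simpa using hL θ θ'
    have h2 : |fn a d φ α n ((d : ℝ) ^ 1 * θ) (fn a d φ α 1 θ x) -
        fn a d φ α n ((d : ℝ) ^ 1 * θ) (fn a d φ α 1 θ' x)| ≤
        C₁ * R₁ ^ n * |fn a d φ α 1 θ x - fn a d φ α 1 θ' x| := by
      have := Convex.norm_image_sub_le_of_norm_deriv_le (𝕜 := ℝ)
        (f := fun y => fn a d φ α n ((d : ℝ) ^ 1 * θ) y) (s := Icc (-β) β) (C := C₁ * R₁ ^ n)
        (fun y _ => (hasDerivAt_fn n _ y).differentiableAt) (fun y hy => hder _ y hy n)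
        (convex_Icc _ _) (hmem θ') (hmem θ)
      simpa only [Real.norm_eq_abs] using this
    have h3 := ih ((d : ℝ) ^ 1 * θ) ((d : ℝ) ^ 1 * θ') _ (hmem θ')
    rw [← mul_sub, abs_mul, abs_of_nonneg (by positivity : (0 : ℝ) ≤ (d : ℝ) ^ 1)] at h3
    have hC : 0 ≤ C₁ * R₁ ^ n := by positivity
    calc _ ≤ C₁ * R₁ ^ n * (α * (L * |θ - θ'|)) + α * (L * C₁ * (((d : ℝ) ^ n - R₁ ^ n) / (d - R₁))) *
          ((d : ℝ) ^ 1 * |θ - θ'|) :=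
          (abs_sub_le _ _ _).trans (add_le_add (h2.trans (mul_le_mul_of_nonneg_left h1 hC)) h3)
      _ = _ := by
          field_simp
          ring

lemma Admissible.lipschitz {L C₁ R₁ : ℝ} (hd : 2 ≤ d) (hα : 0 < α) (hφb : ∀ θ : ℝ, |φ θ| ≤ 1)
    (hL0 : 0 ≤ L) (hL : ∀ x y, |φ x - φ y| ≤ L * |x - y|)
    (hinv : ∀ x ∈ Icc (-β) β, ∀ t : ℝ, |t| ≤ α → qm a x + t ∈ Icc (-β) β)
    (hC₁ : 0 < C₁) (hR : R₁ ∈ Ioo (0 : ℝ) 2)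
    (hder : ∀ θ x : ℝ, x ∈ Icc (-β) β → ∀ k : ℕ, |deriv (fun y => fn a d φ α k θ y) x| ≤ C₁ * R₁ ^ k)
    {n₀ : ℕ} {X : ℝ → ℝ} (hX : Admissible a d φ α β n₀ X) {θ θ' : ℝ} (hθ : θ ∈ Ico (0 : ℝ) 1)
    (hθ' : θ' ∈ Ico (0 : ℝ) 1) : |X θ - X θ'| ≤ α * (L * C₁ / (d - R₁)) := by
  obtain ⟨n, -, j, -, x₀, hx₀, h⟩ := hX
  have hd2 : (2 : ℝ) ≤ d := by exact_mod_cast hd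
  have hdR : 0 < (d : ℝ) - R₁ := by linarith [hR.2]
  have hdn : 0 < (d : ℝ) ^ n := by positivity
  have hRn : 0 ≤ R₁ ^ n := pow_nonneg hR.1.le n
  rw [h θ hθ, h θ' hθ']
  refine (fn_lipschitz hd hα hφb hL hinv hC₁ hR hder n _ _ x₀ hx₀).trans ?_
  have h1 : |(θ + j) / (d : ℝ) ^ n - (θ' + j) / (d : ℝ) ^ n| ≤ 1 / (d : ℝ) ^ n := by
    rw [← sub_div, add_sub_add_right_eq_sub, abs_div, abs_of_pos hdn]
    gcongr
    rw [abs_le]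
    constructor <;> linarith [hθ.1, hθ.2, hθ'.1, hθ'.2]
  calc _ ≤ α * (L * C₁ * ((d : ℝ) ^ n / (d - R₁))) * (1 / (d : ℝ) ^ n) := by
        gcongr
        linarith
    _ = _ := by field_simp

end curves

/-! ### Counting return times -/

section count

variable {a β α : ℝ} {d : ℕ} {φ : ℝ → ℝ}

/-- The points whose first return time is `n`. -/
def firstRet (a : ℝ) (d : ℕ) (φ : ℝ → ℝ) (α : ℝ) (X : ℝ → ℝ) (n : ℕ) : Set ℝ :=
  {θ | θ ∈ Ico (0 : ℝ) 1 ∧ 1 ≤ n ∧ IsRet a d φ α X θ n ∧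
    ∀ m, 1 ≤ m → m < n → ¬IsRet a d φ α X θ m}

lemma firstRet_subset (X : ℝ → ℝ) (n : ℕ) : firstRet a d φ α X n ⊆ Ico 0 1 := fun _ h => h.1

lemma firstRet_cell (hd : 2 ≤ d) (X : ℝ → ℝ) (n : ℕ) : ∀ θ ∈ firstRet a d φ α X n,
    ∀ θ' ∈ Ico (0 : ℝ) 1, ⌊θ' * ((d ^ n : ℕ) : ℝ)⌋ = ⌊θ * ((d ^ n : ℕ) : ℝ)⌋ →
      θ' ∈ firstRet a d φ α X n := by
  rintro θ ⟨-, hn, h1, h2⟩ θ' hθ' h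
  exact ⟨hθ', hn, (isRet_congr hd le_rfl h).2 h1,
    fun m hm hmn hr => h2 m hm hmn ((isRet_congr hd hmn.le h).1 hr)⟩

lemma firstRet_disjoint (X : ℝ → ℝ) (s : Set ℕ) : s.PairwiseDisjoint (firstRet a d φ α X) := by
  intro i _ j _ hij
  refine Set.disjoint_left.2 fun θ hi hj => ?_
  rcases lt_or_gt_of_ne hij with h | h
  · exact hj.2.2.2 i hi.2.1 h hi.2.2.1
  · exact hi.2.2.2 j hj.2.1 h hj.2.2.1

/-- The sum of the weighted measures of the sets of points with given first return time, when there
are no returns before time `N` and few returns until time `N + M`. -/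
lemma sum_volume_firstRet_le (hd : 2 ≤ d) {q p : ℝ} (hq0 : 0 < q) (hq1 : q ≤ 1) {X : ℝ → ℝ}
    {N M : ℕ} (hempty : ∀ n ≤ N, firstRet a d φ α X n = ∅) {T : Set ℝ} (hT : T ⊆ Ico 0 1)
    (hsub : ∀ n ≤ N + M, firstRet a d φ α X n ⊆ T) (hp : volume.real T ≤ p) (b : ℕ) :
    ∑ n ∈ Finset.range b, volume.real (firstRet a d φ α X n) * q ^ n ≤ q ^ N * (p + q ^ M) := by
  set E := firstRet a d φ α X
  have hmeas : ∀ n, MeasurableSet (E n) := fun n =>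
    measurableSet_of_cells (firstRet_subset X n) (firstRet_cell hd X n)
  have hfin : ∀ n, volume (E n) ≠ ∞ := fun n => volume_ne_top_of_subset_Ico (firstRet_subset X n)
  have hsum : ∀ (s : Finset ℕ) (U : Set ℝ), U ⊆ Ico 0 1 → (∀ n ∈ s, E n ⊆ U) →
      ∑ n ∈ s, volume.real (E n) ≤ volume.real U := by
    intro s U hU h
    rw [← measureReal_biUnion_finset (firstRet_disjoint X _) (fun n _ => hmeas n)
      (fun n _ => hfin n)]
    exact measureReal_mono (iUnion₂_subset h) (volume_ne_top_of_subset_Ico hU)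
  have h1 := (hsum ((Finset.range b).filter (· ≤ N + M)) T hT
    fun n hn => hsub n (Finset.mem_filter.1 hn).2).trans hp
  have h2 := hsum (Finset.range b) (Ico 0 1) subset_rfl fun n _ => firstRet_subset X n
  rw [Real.volume_real_Ico_of_le zero_le_one, sub_zero] at h2
  calc ∑ n ∈ Finset.range b, volume.real (E n) * q ^ n
      ≤ ∑ n ∈ Finset.range b, (q ^ N * (if n ≤ N + M then volume.real (E n) else 0) +
          q ^ (N + M) * volume.real (E n)) := by
        refine Finset.sum_le_sum fun n _ => ?_
        have h0 : 0 ≤ volume.real (E n) := measureReal_nonneg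
        have hqp : 0 ≤ q ^ (N + M) * volume.real (E n) := by positivity
        rcases le_or_gt n N with hn | hn
        · simp [hempty n hn, E]
        · split_ifs with h
          · have := mul_le_mul_of_nonneg_right (pow_le_pow_of_le_one hq0.le hq1 hn.le) h0
            linarith
          · have := mul_le_mul_of_nonneg_right
              (pow_le_pow_of_le_one hq0.le hq1 (not_le.1 h).le) h0
            linarith
    _ = q ^ N * ∑ n ∈ (Finset.range b).filter (· ≤ N + M), volume.real (E n) +
          q ^ (N + M) * ∑ n ∈ Finset.range b, volume.real (E n) := by
        rw [Finset.sum_add_distrib, ← Finset.mul_sum, ← Finset.mul_sum, Finset.sum_filter]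
    _ ≤ q ^ N * p + q ^ (N + M) * 1 := by gcongr
    _ = _ := by rw [pow_add]; ring

open Classical in
lemma count_le_of_firstRet (hd : 2 ≤ d) (hφp : Function.Periodic φ 1) {X : ℝ → ℝ} {n j : ℕ}
    (hj : j < d ^ n) {t : ℝ} (ht : t ∈ Ico (0 : ℝ) 1)
    (h : (t + j) / ((d ^ n : ℕ) : ℝ) ∈ firstRet a d φ α X n) {b : ℕ} (hnb : n ≤ b) :
    Nat.count (IsRet a d φ α X ((t + j) / ((d ^ n : ℕ) : ℝ))) (b + 1) ≤
      1 + Nat.count (IsRet a d φ α (cellCurve a d φ α X n j) t) (b - n + 1) := by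
  obtain ⟨-, hn, h1, h2⟩ := h
  rw [show b + 1 = n + (b - n + 1) by omega, Nat.count_add]
  refine add_le_add ?_ (Nat.count_mono_left fun m _ hm => ?_)
  · obtain ⟨k, rfl⟩ := Nat.exists_eq_add_of_le' hn
    have h3 := (Nat.count_iff_forall_not
      (p := fun m => IsRet a d φ α X ((t + j) / ((d ^ (k + 1) : ℕ) : ℝ)) (m + 1)) (n := k)).2
      fun m hm => h2 (m + 1) (by omega) (by omega)
    rw [Nat.count_succ', h3]
    split_ifs <;> omega
  · rcases Nat.eq_zero_or_pos m with rfl | hm0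
    · exact Or.inl rfl
    · exact (isRet_cellCurve_iff hd hφp hj ht hm0).1 hm

open Classical in
lemma volume_count_le (hd : 2 ≤ d) (hφp : Function.Periodic φ 1) {P : (ℝ → ℝ) → Prop} {q γ : ℝ}
    (hq0 : 0 < q) (hq1 : q ≤ 1) (hγ : 0 ≤ γ)
    (hcell : ∀ X, P X → ∀ n, ∀ j < d ^ n, ∀ t ∈ Ico (0 : ℝ) 1,
      (t + j) / ((d ^ n : ℕ) : ℝ) ∈ firstRet a d φ α X n → P (cellCurve a d φ α X n j))
    (hsum : ∀ X, P X → ∀ b, ∑ n ∈ Finset.range b, volume.real (firstRet a d φ α X n) * q ^ n ≤ γ)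
    (k : ℕ) : ∀ X, P X → ∀ b,
      volume.real {θ | θ ∈ Ico (0 : ℝ) 1 ∧ k < Nat.count (IsRet a d φ α X θ) (b + 1)} * q ^ b ≤
        γ ^ k := by
  induction k with
  | zero =>
    intro X _ b
    have h1 : volume.real {θ | θ ∈ Ico (0 : ℝ) 1 ∧ 0 < Nat.count (IsRet a d φ α X θ) (b + 1)} ≤ 1 := by
      refine (measureReal_mono (fun θ h => h.1) (by simp)).trans_eq
        (Real.volume_real_Ico_of_le zero_le_one) |>.trans (by norm_num)
    rw [pow_zero]
    exact mul_le_one₀ h1 (by positivity) (pow_le_one₀ hq0.le hq1)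
  | succ k ih =>
    intro X hX b
    set S := {θ | θ ∈ Ico (0 : ℝ) 1 ∧ k + 1 < Nat.count (IsRet a d φ α X θ) (b + 1)}
    set E := firstRet a d φ α X with hE
    have hSsub : S ⊆ ⋃ n ∈ Finset.range (b + 1), S ∩ E n := by
      intro θ hθ
      have hex : ∃ n, 1 ≤ n ∧ n ≤ b ∧ IsRet a d φ α X θ n := by
        by_contra! hcon
        have h1 := hθ.2
        rw [Nat.count_succ', Nat.count_eq_card_filter_range, Finset.filter_false_of_mem] at h1
        · simp only [Finset.card_empty] at h1
          split_ifs at h1 <;> omega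
        · intro m hm
          exact hcon (m + 1) (by omega) (by have := Finset.mem_range.1 hm; omega)
      obtain ⟨h1, h2, h3⟩ := Nat.find_spec hex
      refine mem_biUnion (x := Nat.find hex) (Finset.mem_coe.2 (Finset.mem_range.2 (by omega)))
        ⟨hθ, hθ.1, h1, h3, fun m hm hmn hr => Nat.find_min hex hmn ⟨hm, by omega, hr⟩⟩
    have hterm : ∀ n ∈ Finset.range (b + 1),
        volume.real (S ∩ E n) ≤ volume.real (E n) * (γ ^ k / q ^ (b - n)) := by
      intro n hn
      have hnb : n ≤ b := by have := Finset.mem_range.1 hn; omega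
      refine volume_le_of_cells (D := d ^ n) (by positivity) (by positivity) (firstRet_subset X n)
        (firstRet_cell hd X n) inter_subset_right fun j hj t₀ ht₀ hmem => ?_
      rw [le_div_iff₀ (by positivity)]
      refine le_trans ?_ (ih _ (hcell X hX n j hj t₀ ht₀ hmem) (b - n))
      gcongr ?_ * _
      refine measureReal_mono ?_ (volume_ne_top_of_subset_Ico fun t ht => ht.1)
      rintro t ⟨ht, hS, hEt⟩
      have h1 := count_le_of_firstRet hd hφp hj ht hEt hnb
      have h2 := hS.2
      exact ⟨ht, by omega⟩
    have hSfin : volume (⋃ n ∈ Finset.range (b + 1), S ∩ E n) ≠ ∞ :=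
      volume_ne_top_of_subset_Ico (iUnion₂_subset fun n _ θ hθ => hθ.1.1)
    calc volume.real S * q ^ b
        ≤ (∑ n ∈ Finset.range (b + 1), volume.real (E n) * (γ ^ k / q ^ (b - n))) * q ^ b := by
          gcongr
          exact (measureReal_mono hSsub hSfin).trans
            ((measureReal_biUnion_finset_le _ _).trans (Finset.sum_le_sum hterm))
      _ = γ ^ k * ∑ n ∈ Finset.range (b + 1), volume.real (E n) * q ^ n := by
          rw [Finset.sum_mul, Finset.mul_sum]
          refine Finset.sum_congr rfl fun n hn => ?_
          have hnb : n ≤ b := by have := Finset.mem_range.1 hn; omega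
          have hqb : q ^ b = q ^ (b - n) * q ^ n := by rw [← pow_add, Nat.sub_add_cancel hnb]
          rw [hqb]
          field_simp
      _ ≤ γ ^ (k + 1) := by
          rw [pow_succ]
          gcongr
          exact hsum X hX _

open Classical in
lemma lt_count_of_nk_le {X : ℝ → ℝ} {θ : ℝ} {k b : ℕ} (hdef : NkDef a d φ α X θ k)
    (h : nk a d φ α X θ k ≤ b) : k < Nat.count (IsRet a d φ α X θ) (b + 1) := by
  have h1 : Nat.count (IsRet a d φ α X θ) (nk a d φ α X θ k + 1) = k + 1 := by
    refine Nat.count_nth_succ fun hf => ?_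
    rcases hdef with hinf | hlt
    · exact absurd hf hinf
    · rwa [Set.ncard_eq_toFinset_card _ hf] at hlt
  have h2 := Nat.count_monotone (IsRet a d φ α X θ) (Nat.succ_le_succ h)
  simp only [Nat.succ_eq_add_one] at h2
  omega

end count

section final

variable {a β ξ₀ : ℝ} {d : ℕ} {φ : ℝ → ℝ}

open Classical in
/-- The distribution of the number of returns of a curve to the critical region. -/
lemma eventually_volume_count_le {L C₁ R₁ α₁ c σ : ℝ} (hd : 2 ≤ d) (hφc : Continuous φ)
    (hφp : Function.Periodic φ 1) (hφb : ∀ θ : ℝ, |φ θ| ≤ 1) (hL0 : 0 ≤ L)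
    (hL : ∀ x y, |φ x - φ y| ≤ L * |x - y|) (hβ1 : 1 < β)
    (hβmap : ∀ x ∈ Icc (-β) β, qm a x ∈ Ioo (-β) β) (n₀ : ℕ) (hC₁ : 0 < C₁)
    (hR : R₁ ∈ Ioo (0 : ℝ) 2) (hα₁ : 0 < α₁)
    (hdom : ∀ α : ℝ, 0 < α → α < α₁ → ∀ θ x : ℝ, x ∈ Icc (-β) β → ∀ k : ℕ,
      |deriv (fun y => fn a d φ α k θ y) x| ≤ C₁ * R₁ ^ k)
    (hξ₀ : 0 < ξ₀) (hx : ∀ n, 2 * ξ₀ ≤ |(qm a)^[n + 1] 0|) (hx2 : ∀ n, |(qm a)^[n + 1] 0| ≤ 2)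
    (hE0 : ∀ i, Eseq a i ≠ 0) (hc : 0 < c) (hσ : 1 < σ)
    (hg : ∀ n l, c * σ ^ l * |Eseq a n| ≤ |Eseq a (n + l)|)
    (hnull : ∀ v, volume ({θ | tser φ d (Eseq a) θ = v} ∩ Icc (0 : ℝ) 1) = 0)
    {q : ℝ} (hq0 : 0 < q) (hq1 : q < 1) :
    ∀ᶠ α in nhdsWithin (0 : ℝ) (Ioi 0), ∀ k : ℕ, ∀ X : ℝ → ℝ,
      (Admissible a d φ α β n₀ X ∧ ∀ θ ∈ Ico (0 : ℝ) 1, |X θ| ≤ 2 * α ^ (0.6 : ℝ)) → ∀ b : ℕ,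
        volume.real {θ | θ ∈ Ico (0 : ℝ) 1 ∧ k < Nat.count (IsRet a d φ α X θ) (b + 1)} * q ^ b ≤
          (q ^ Nal a ξ₀ α * 0.6) ^ k := by
  obtain ⟨M, hM⟩ := exists_pow_lt_of_lt_one (show (0 : ℝ) < 0.3 by norm_num) hq1
  obtain ⟨δ, hδ, hinv⟩ := invariant_small hβ1 hβmap
  set K := L * C₁ / (d - R₁)
  have small : ∀ {s C ε : ℝ}, 0 < s → 0 < ε →
      ∀ᶠ α in nhdsWithin (0 : ℝ) (Ioi 0), C * α ^ s < ε := by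
    intro s C ε hs hε
    refine nhdsWithin_le_nhds ((continuous_const.mul
      (Real.continuous_rpow_const hs.le)).continuousAt.eventually_lt continuousAt_const ?_)
    simpa [Real.zero_rpow hs.ne'] using hε
  have ev1 : ∀ᶠ α in nhdsWithin (0 : ℝ) (Ioi 0), α < min α₁ δ :=
    nhdsWithin_le_nhds (eventually_lt_nhds (lt_min hα₁ hδ))
  filter_upwards [ev1, small (s := 0.4) (C := K) (by norm_num) one_pos,
    small (s := 0.2) (C := 4) (by norm_num) one_pos,
    small (s := 0.6) (C := 1) (by norm_num) hξ₀, self_mem_nhdsWithin,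
    volume_early_return hφc hφb hξ₀ hx hx2 hE0 hc hσ hg hnull M
      (ε := ENNReal.ofReal 0.3) (by simp; norm_num)] with α h1 h2 h3 h4 hα hearly
  replace hα : 0 < α := hα
  have hder := hdom α hα (h1.trans_le (min_le_left _ _))
  have hinv' : ∀ x ∈ Icc (-β) β, ∀ t : ℝ, |t| ≤ α → qm a x + t ∈ Icc (-β) β :=
    fun x hx t ht => hinv x hx t (ht.trans (h1.le.trans (min_le_right _ _)))
  have h6 : 0 < α ^ (0.6 : ℝ) := Real.rpow_pos_of_pos hα _
  have h04 : α = α ^ (0.6 : ℝ) * α ^ (0.4 : ℝ) := by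
    rw [← Real.rpow_add hα]; norm_num
  have h02 : α ^ (0.6 : ℝ) * α ^ (0.6 : ℝ) = α * α ^ (0.2 : ℝ) := by
    rw [← Real.rpow_add hα, ← Real.rpow_one_add' hα.le (by norm_num)]; norm_num
  set N := Nal a ξ₀ α
  -- all points of a cell containing a return are near the critical point
  have hreturn : ∀ X : ℝ → ℝ, Admissible a d φ α β n₀ X → ∀ n, 1 ≤ n → ∀ j < d ^ n,
      ∀ t₀ ∈ Ico (0 : ℝ) 1, IsRet a d φ α X ((t₀ + j) / ((d ^ n : ℕ) : ℝ)) n →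
      ∀ t ∈ Ico (0 : ℝ) 1, |cellCurve a d φ α X n j t| ≤ 2 * α ^ (0.6 : ℝ) := by
    rintro X hX n hn j hj t₀ ht₀ (h0 | ⟨-, θ', hθ', hfl, hle⟩) t ht
    · omega
    have hdn : 0 < d ^ n := by positivity
    obtain ⟨i, hi, s, hs, rfl⟩ := exists_cell hdn hθ'
    rw [← Nat.cast_pow, floor_cell hdn hs, floor_cell hdn ht₀] at hfl
    obtain rfl : i = j := by exact_mod_cast hfl
    have hlip := (hX.cellCurve hd hφp hj).lipschitz hd hα hφb hL0 hL hinv' hC₁ hR hder ht hs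
    have hK : α * K ≤ α ^ (0.6 : ℝ) := by
      calc α * K = α ^ (0.6 : ℝ) * (K * α ^ (0.4 : ℝ)) := by
            nth_rewrite 1 [h04]
            ring
        _ ≤ α ^ (0.6 : ℝ) := mul_le_of_le_one_right h6.le h2.le
    have hle' : |cellCurve a d φ α X n i s| ≤ α ^ (0.6 : ℝ) := hle
    have := abs_sub_abs_le_abs_sub (cellCurve a d φ α X n i t) (cellCurve a d φ α X n i s)
    linarith
  refine volume_count_le hd hφp hq0 hq1.le (by positivity) ?_ ?_
  · rintro X ⟨hX, -⟩ n j hj t ht ⟨-, hn, hr, -⟩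
    exact ⟨hX.cellCurve hd hφp hj, hreturn X hX n hn j hj t ht hr⟩
  · rintro X ⟨hX, hXs⟩ b
    have hempty : ∀ n ≤ N, firstRet a d φ α X n = ∅ := by
      intro n hn
      refine eq_empty_of_forall_notMem ?_
      rintro θ ⟨-, hn1, h0 | ⟨-, θ', hθ', -, hle⟩, -⟩
      · omega
      have hX2 : X θ' ^ 2 ≤ α := by
        have h7 := hXs θ' hθ'
        have h8 := abs_nonneg (X θ')
        rw [← sq_abs]
        nlinarith
      have := lt_abs_fn_of_le_Nal (d := d) (θ := θ') hφb hα hξ₀ hx hX2 hn1 hn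
      linarith
    set T := {θ | θ ∈ Ico (0 : ℝ) 1 ∧ ∃ i ≤ M, |fn a d φ α (N + i) θ (X θ)| ≤ 2 * α ^ (0.6 : ℝ)}
    have hT : volume.real T ≤ 0.3 := ENNReal.toReal_le_of_le_ofReal (by norm_num) (hearly X hXs)
    have hsub : ∀ n ≤ N + M, firstRet a d φ α X n ⊆ T := by
      intro n hn θ hθ
      rcases le_or_gt n N with hnN | hnN
      · rw [hempty n hnN] at hθ
        exact absurd hθ (notMem_empty _)
      obtain ⟨hθ1, hn1, hr, -⟩ := hθ
      refine ⟨hθ1, n - N, by omega, ?_⟩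
      rw [Nat.add_sub_cancel' hnN.le]
      obtain ⟨j, hj, t, ht, rfl⟩ := exists_cell (D := d ^ n) (by positivity) hθ1
      exact hreturn X hX n hn1 j hj t ht hr t ht
    refine (sum_volume_firstRet_le hd hq0 hq1.le hempty (fun θ h => h.1) hsub hT b).trans ?_
    gcongr
    linarith

end final

/-- Given `M > 0`, for `α > 0` small enough: for each `k ≥ 1`, the set
`ℬ_k(M) = {θ ∈ [0,1) : n_k(θ) ≤ (N(α)+M) k}` has measure at most `0.8^k`; in particular, for
a.e. `θ` with all `n_k(θ)` defined, `n_k(θ) > (N(α)+M) k` for all large `k`. -/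
theorem slow_return_times
    (a : ℝ) (ha : a ∈ Set.Ioo (1 : ℝ) 2) (hpre : StrictlyPreperiodic a)
    (d : ℕ) (hd : 2 ≤ d)
    (φ : ℝ → ℝ) (hφa : ∀ x : ℝ, AnalyticAt ℝ φ x) (hφp : Function.Periodic φ 1)
    (hφnc : ∃ s t : ℝ, φ s ≠ φ t) (hφb : ∀ θ : ℝ, |φ θ| ≤ 1)
    (β : ℝ) (hβ1 : 1 < β) (hβ2 : β < |(-1 - Real.sqrt (1 + 4 * a)) / 2|)
    (hβmap : ∀ x ∈ Set.Icc (-β) β, qm a x ∈ Set.Ioo (-β) β)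
    (hβder : ∀ x : ℝ, β ≤ |x| → 2 * β ≤ |deriv (qm a) x|)
    (n₀ : ℕ)
    (hdom : ∃ C₁ R₁ : ℝ, 0 < C₁ ∧ R₁ ∈ Set.Ioo (0 : ℝ) 2 ∧ ∃ α₁ > 0, ∀ α : ℝ, 0 < α → α < α₁ →
      ∀ θ x : ℝ, x ∈ Set.Icc (-β) β → ∀ k : ℕ,
        |deriv (fun y => fn a d φ α k θ y) x| ≤ C₁ * R₁ ^ k ∧
        (n₀ ≤ k → |deriv (fun y => fn a d φ α k θ y) x| ≤ R₁ ^ k ∧ R₁ ^ k ≤ (d : ℝ) ^ k / 6))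
    (ξ₀ : ℝ) (hξ₀ : 0 < ξ₀)
    (hcrit : ∀ i : ℕ, 1 ≤ i → (qm a)^[i] 0 ∉ Set.Ioo (-(2 * ξ₀)) (2 * ξ₀))
    :
    ∀ M : ℕ, 0 < M → ∃ α₀ > 0, ∀ α : ℝ, 0 < α → α < α₀ → α ≤ ξ₀ →
      ∀ X : ℝ → ℝ, Admissible a d φ α β n₀ X →
        Set.MapsTo X (Set.Ico (0 : ℝ) 1)
          (Set.Icc (-(2 * α ^ (0.6 : ℝ))) (2 * α ^ (0.6 : ℝ))) →
        (∀ k : ℕ, 1 ≤ k →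
          volume {θ : ℝ | θ ∈ Set.Ico (0 : ℝ) 1 ∧ NkDef a d φ α X θ k ∧
              nk a d φ α X θ k ≤ (Nal a ξ₀ α + M) * k} ≤
            ENNReal.ofReal ((0.8 : ℝ) ^ k)) ∧
        ∀ᵐ θ ∂(volume.restrict (Set.Ico (0 : ℝ) 1)),
          (∀ k : ℕ, NkDef a d φ α X θ k) →
            ∀ᶠ k in Filter.atTop, (Nal a ξ₀ α + M) * k < nk a d φ α X θ k := by
  classical
  intro M hM
  have hφc : Continuous φ := continuous_iff_continuousAt.2 fun x => (hφa x).continuousAt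
  obtain ⟨L, hL0, hL⟩ := exists_lipschitz_of_periodic hφa hφp
  obtain ⟨C₁, R₁, hC₁, hR, α₁, hα₁, hder⟩ := hdom
  replace hder : ∀ α : ℝ, 0 < α → α < α₁ → ∀ θ x : ℝ, x ∈ Icc (-β) β → ∀ k : ℕ,
      |deriv (fun y => fn a d φ α k θ y) x| ≤ C₁ * R₁ ^ k :=
    fun α h h' θ x hx k => (hder α h h' θ x hx k).1
  obtain ⟨m, p, Λ, hp, hΛ1, hΛd, hper⟩ := exists_critical_period ha.2 hpre hd hφc hβ1 hβ2 hβmap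
    ⟨C₁, R₁, hR, α₁, hα₁, hder⟩
  have hE0 : ∀ i, Eseq a i ≠ 0 := Eseq_ne_zero hpre.1
  obtain ⟨c, σ, hc, hσ, hg⟩ := exists_growth hE0 hp hΛ1 hper
  have hsummable : Summable fun i => 1 / |Eseq a i| := by
    simpa using (tail_inv_bound hE0 hc hσ hg 0).1
  have hnull := volume_tser_level hd hφa hφp hφnc hφb hsummable hE0 hp (by linarith) hΛd hper
  have hx : ∀ n, 2 * ξ₀ ≤ |(qm a)^[n + 1] 0| := fun n => by
    by_contra! h
    exact hcrit (n + 1) (by omega) (abs_lt.1 h)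
  have hx2 : ∀ n, |(qm a)^[n + 1] 0| ≤ 2 := fun n =>
    (abs_le.2 (orbit_mem hβ1 hβmap (n + 1))).trans (beta_lt_two ha.2 hβ2).le
  have hM1 : (1 : ℝ) ≤ M := by exact_mod_cast hM
  set q : ℝ := 1 + -(1 / (4 * M)) with hq
  have hM4 : 1 / (4 * (M : ℝ)) ≤ 1 / 4 := by
    apply one_div_le_one_div_of_le <;> linarith
  have hM0 : 0 < 1 / (4 * (M : ℝ)) := by positivity
  have hq0 : 0 < q := by linarith
  have hqM : 3 / 4 ≤ q ^ M := by
    refine le_trans (le_of_eq ?_)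
      (one_add_mul_le_pow (show (-2 : ℝ) ≤ -(1 / (4 * M)) by linarith) M)
    field_simp
    norm_num
  obtain ⟨α₀, hα₀, h⟩ := mem_nhdsGT_iff_exists_Ioo_subset.1
    (eventually_volume_count_le hd hφc hφp hφb hL0 hL hβ1 hβmap n₀ hC₁ hR hα₁ hder hξ₀ hx hx2 hE0
      hc hσ hg hnull hq0 (by linarith))
  refine ⟨α₀, hα₀, fun α hα hαα₀ _ X hX hXs => ?_⟩
  have hcount := h ⟨hα, hαα₀⟩
  set N := Nal a ξ₀ α
  have hmain : ∀ k : ℕ, volume {θ : ℝ | θ ∈ Ico (0 : ℝ) 1 ∧ NkDef a d φ α X θ k ∧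
      nk a d φ α X θ k ≤ (N + M) * k} ≤ ENNReal.ofReal ((0.8 : ℝ) ^ k) := by
    intro k
    set S := {θ | θ ∈ Ico (0 : ℝ) 1 ∧ k < Nat.count (IsRet a d φ α X θ) ((N + M) * k + 1)}
    have hS : volume S ≠ ∞ := volume_ne_top_of_subset_Ico fun θ h => h.1
    refine (measure_mono fun θ hθ => (⟨hθ.1, lt_count_of_nk_le hθ.2.1 hθ.2.2⟩ : θ ∈ S)).trans ?_
    refine (ENNReal.le_ofReal_iff_toReal_le hS (by positivity)).2 ?_
    have h1 := hcount k X ⟨hX, fun θ hθ => abs_le.2 (hXs hθ)⟩ ((N + M) * k)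
    have h2 : (q ^ N * 0.6) ^ k ≤ 0.8 ^ k * q ^ ((N + M) * k) := by
      rw [pow_mul, ← mul_pow]
      refine pow_le_pow_left₀ (by positivity) ?_ k
      rw [pow_add]
      nlinarith [pow_pos hq0 N]
    exact le_of_mul_le_mul_right (h1.trans h2) (by positivity)
  refine ⟨fun k _ => hmain k, ?_⟩
  rw [ae_restrict_iff' measurableSet_Ico]
  have hsum : ∑' k : ℕ, volume {θ : ℝ | θ ∈ Ico (0 : ℝ) 1 ∧ NkDef a d φ α X θ k ∧
      nk a d φ α X θ k ≤ (N + M) * k} ≠ ∞ :=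
    ne_top_of_le_ne_top (summable_geometric_of_lt_one (r := (0.8 : ℝ)) (by norm_num)
      (by norm_num)).tsum_ofReal_ne_top (ENNReal.tsum_le_tsum hmain)
  filter_upwards [ae_eventually_notMem hsum] with θ hev hθ hdef
  filter_upwards [hev] with k hk
  by_contra! hcon
  exact hk ⟨hθ, hdef k, hcon⟩
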